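/- A commutative noetherian ring A of finite Krull dimension is Gorenstein if and only if every acyclic cochain complex of projective A-modules is totally acyclic. -/

import Mathlib

universe u

/-- A cochain complex `(X, d)` of projective `A`-modules is *totally acyclic* if it is acyclic
and `Hom_A(X, Q)` is acyclic for every projective `A`-module `Q`. -/
def IsTotallyAcyclic (A : Type u) [CommRing A] (X : ℤ → Type u)
    [∀ n, AddCommGroup (X n)] [∀ n, Module A (X n)]
    (d : ∀ n, X n →ₗ[A] X (n + 1)) : Prop :=
  (∀ n, Function.Exact (d n) (d (n + 1))) ∧
  ∀ (Q : Type u) [AddCommGroup Q] [Module A Q], Module.Projective A Q →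
    ∀ n, Function.Exact (LinearMap.lcomp A Q (d (n + 1))) (LinearMap.lcomp A Q (d n))

/-- An `R`-module `M` has finite injective dimension: there is a finite injective
coresolution `0 → M → I⁰ → I¹ → ⋯ → Iⁿ → 0`. -/
def HasFiniteInjectiveDimension (R : Type u) [CommRing R] (M : Type u) [AddCommGroup M]
    [Module R M] : Prop :=
  ∃ (n : ℕ) (I : ℕ → Type u) (_ : ∀ j, AddCommGroup (I j)) (_ : ∀ j, Module R (I j))
    (ι : M →ₗ[R] I 0) (d : ∀ j, I j →ₗ[R] I (j + 1)),
    (∀ j, Module.Injective R (I j)) ∧ Function.Injective ι ∧ Function.Exact ι (d 0) ∧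
    (∀ j, Function.Exact (d j) (d (j + 1))) ∧ ∀ j, n < j → Subsingleton (I j)

/-- A commutative noetherian ring is Gorenstein if each localization at a prime has finite
injective dimension over itself. -/
def IsGorensteinRing (A : Type u) [CommRing A] : Prop :=
  ∀ (p : Ideal A) (_ : p.IsPrime),
    HasFiniteInjectiveDimension (Localization.AtPrime p) (Localization.AtPrime p)

set_option autoImplicit false
open CategoryTheory CategoryTheory.Abelian

lemma gor_injDim_of_ideals {R : Type u} [CommRing R] (n : ℕ) (M : ModuleCat.{u} R)
    (h : ∀ I : Ideal R, Subsingleton (Ext.{u} (ModuleCat.of R (R ⧸ I)) M (n + 1))) :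
    HasInjectiveDimensionLE M n := by
  induction n generalizing M with
  | zero =>
    rw [HasInjectiveDimensionLE, zero_add, ← injective_iff_hasInjectiveDimensionLT_one,
      ← Module.injective_iff_injective_object R M, ← Module.Baer.iff_injective]
    intro I g
    have surj : Function.Surjective (Submodule.mkQ I) := Submodule.mkQ_surjective I
    have hS := LinearMap.shortExact_shortComplexKer surj
    have := h I
    let e : LinearMap.ker (Submodule.mkQ I) ≃ₗ[R] I := LinearEquiv.ofEq _ _ (Submodule.ker_mkQ I)
    obtain ⟨x, hx⟩ := Ext.contravariant_sequence_exact₁ hS M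
      (Ext.mk₀ (ModuleCat.ofHom (g.comp e.toLinearMap))) (n₁ := 1) rfl (Subsingleton.elim _ _)
    obtain ⟨f, rfl⟩ := (Ext.mk₀_bijective _ _).2 x
    rw [Ext.mk₀_comp_mk₀, (Ext.mk₀_bijective _ _).1.eq_iff] at hx
    refine ⟨f.hom, fun x hxI => ?_⟩
    have := congr($hx (e.symm ⟨x, hxI⟩))
    have h2 : e (e.symm ⟨x, hxI⟩) = ⟨x, hxI⟩ := e.apply_symm_apply _
    exact this.trans (congrArg g h2)
  | succ n ih =>
    have ei : EnoughInjectives (ModuleCat.{u} R) := inferInstance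
    rcases ei.1 M with ⟨I, inj, f, monof⟩
    let S := ShortComplex.mk f (Limits.cokernel.π f) (Limits.cokernel.condition f)
    have hS : S.ShortExact := { exact := ShortComplex.exact_cokernel f }
    have := ih S.X₃ (fun J => by
      have := h J
      refine ⟨fun a b => ?_⟩
      rw [← sub_eq_zero]
      obtain ⟨x, hx⟩ := Ext.covariant_sequence_exact₃ _ hS (a - b) (n₁ := n + 1 + 1) rfl
        (Subsingleton.elim _ _)
      have : x = 0 := Ext.eq_zero_of_injective _
      rw [← hx, this, Ext.zero_comp])
    exact (hS.hasInjectiveDimensionLT_X₃_iff n ‹_›).mp this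

lemma gor_ses {R : Type u} [CommRing R] {M N L : Type u} [AddCommGroup M] [Module R M]
    [AddCommGroup N] [Module R N] [AddCommGroup L] [Module R L] (f : M →ₗ[R] N) (g : N →ₗ[R] L)
    (hf : Function.Injective f) (hg : Function.Surjective g) (h : Function.Exact f g)
    (w : ModuleCat.ofHom f ≫ ModuleCat.ofHom g = 0) :
    (ShortComplex.mk (ModuleCat.ofHom f) (ModuleCat.ofHom g) w).ShortExact :=
  { exact := by
      rw [ShortComplex.ShortExact.moduleCat_exact_iff_function_exact]
      exact h
    mono_f := (ModuleCat.mono_iff_injective _).2 hf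
    epi_g := (ModuleCat.epi_iff_surjective _).2 hg }

lemma gor_ofHom_zero {R : Type u} [CommRing R] {M N L : Type u} [AddCommGroup M] [Module R M]
    [AddCommGroup N] [Module R N] [AddCommGroup L] [Module R L] {f : M →ₗ[R] N} {g : N →ₗ[R] L}
    (h : Function.Exact f g) :
    ModuleCat.ofHom f ≫ ModuleCat.ofHom g = 0 := by
  ext x
  exact h.apply_apply_eq_zero x

lemma gor_exists_inj {R : Type u} [CommRing R] (M : Type u) [AddCommGroup M] [Module R M] :
    ∃ (I : Type u) (_ : AddCommGroup I) (_ : Module R I) (f : M →ₗ[R] I),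
      Module.Injective R I ∧ Function.Injective f := by
  have ei : EnoughInjectives (ModuleCat.{u} R) := inferInstance
  rcases ei.1 (ModuleCat.of R M) with ⟨I, inj, f, monof⟩
  exact ⟨I, _, _, f.hom, (Module.injective_iff_injective_object R I).2 inj,
    (ModuleCat.mono_iff_injective _).1 monof⟩

lemma gor_to_finite {R : Type u} [CommRing R] (M : Type u) [AddCommGroup M] [Module R M] (n : ℕ)
    (h : HasInjectiveDimensionLE (ModuleCat.of R M) n) : HasFiniteInjectiveDimension R M := by
  induction n generalizing M with
  | zero =>
    rw [HasInjectiveDimensionLE, zero_add, ← injective_iff_hasInjectiveDimensionLT_one,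
      ← Module.injective_iff_injective_object] at h
    refine ⟨0, fun j => Nat.rec M (fun _ _ => PUnit.{u + 1}) j,
      fun j => match j with | 0 => ‹_› | j + 1 => (inferInstance : AddCommGroup PUnit.{u + 1}),
      fun j => match j with | 0 => ‹Module R M› | j + 1 => (inferInstance : Module R PUnit.{u + 1}),
      LinearMap.id, fun j => 0, ?_, Function.injective_id, ?_, ?_, ?_⟩
    · rintro (_ | j)
      · exact h
      · exact ⟨fun X Y _ _ _ _ f hf g => ⟨0, fun x => rfl⟩⟩
    · intro x
      exact ⟨fun _ => ⟨x, rfl⟩, fun _ => rfl⟩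
    · rintro (_ | j) x
      · exact ⟨fun _ => ⟨(0 : M), rfl⟩, fun _ => rfl⟩
      · exact ⟨fun _ => ⟨PUnit.unit, rfl⟩, fun _ => rfl⟩
    · rintro (_ | j) hj
      · omega
      · exact (inferInstance : Subsingleton PUnit.{u + 1})
  | succ n ih =>
    obtain ⟨I, _, _, f, hI, hf⟩ := gor_exists_inj (R := R) M
    let N := I ⧸ LinearMap.range f
    let π : I →ₗ[R] N := Submodule.mkQ _
    have hex : Function.Exact f π := fun x => by
      rw [Submodule.mkQ_apply, Submodule.Quotient.mk_eq_zero]; rfl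
    have hS := gor_ses f π hf (Submodule.mkQ_surjective _) hex (gor_ofHom_zero hex)
    have hinj : Injective (ModuleCat.of R I) := (Module.injective_iff_injective_object R I).1 hI
    have h3 := (hS.hasInjectiveDimensionLT_X₃_iff n hinj).mpr h
    obtain ⟨m, J, _, _, ι, d, hJ, hι, h0, hd, hm⟩ := ih N h3
    refine ⟨m + 1, fun j => Nat.rec I (fun k _ => J k) j,
      fun j => match j with | 0 => ‹_› | j + 1 => ‹∀ j, AddCommGroup (J j)› j,
      fun j => match j with | 0 => ‹Module R I› | j + 1 => ‹∀ j, Module R (J j)› j,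
      f, fun j => match j with | 0 => ι.comp π | j + 1 => d j, ?_, hf, ?_, ?_, ?_⟩
    · rintro (_ | j)
      · exact hI
      · exact hJ j
    · intro x
      rw [← hex x]
      change ι (π x) = 0 ↔ _
      rw [map_eq_zero_iff _ hι]
    · rintro (_ | j)
      · intro x
        refine (h0 x).trans ?_
        constructor
        · rintro ⟨y, rfl⟩
          obtain ⟨z, rfl⟩ := Submodule.mkQ_surjective _ y
          exact ⟨z, rfl⟩
        · rintro ⟨z, rfl⟩
          exact ⟨π z, rfl⟩
      · exact hd j
    · rintro (_ | j) hj
      · omega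
      · exact hm j (by omega)

lemma gor_of_finite {R : Type u} [CommRing R] (M : Type u) [AddCommGroup M] [Module R M] (n : ℕ)
    (I : ℕ → Type u) [∀ j, AddCommGroup (I j)] [∀ j, Module R (I j)]
    (ι : M →ₗ[R] I 0) (d : ∀ j, I j →ₗ[R] I (j + 1))
    (hI : ∀ j, Module.Injective R (I j)) (hι : Function.Injective ι) (h0 : Function.Exact ι (d 0))
    (hd : ∀ j, Function.Exact (d j) (d (j + 1))) (hn : ∀ j, n < j → Subsingleton (I j)) :
    HasInjectiveDimensionLE (ModuleCat.of R M) n := by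
  induction n generalizing M I with
  | zero =>
    have := hn 1 (by simp)
    have hs : Function.Surjective ι := fun x => (h0 x).1 (Subsingleton.elim _ _)
    let e := LinearEquiv.ofBijective ι ⟨hι, hs⟩
    rw [HasInjectiveDimensionLE, zero_add, ← injective_iff_hasInjectiveDimensionLT_one,
      ← Module.injective_iff_injective_object, ← Module.Baer.iff_injective]
    exact Module.Baer.of_equiv e.symm (Module.Baer.of_injective (hI 0))
  | succ n ih =>
    let N := LinearMap.range (d 0)
    have h3 := ih N (fun j => I (j + 1)) N.subtype (fun j => d (j + 1)) (fun j => hI _)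
      Subtype.val_injective
      (by
        intro x
        rw [hd 0 x]
        simp [N])
      (fun j => hd _) (fun j hj => hn _ (by omega))
    let S : ShortComplex (ModuleCat.{u} R) := ShortComplex.mk (ModuleCat.ofHom ι)
      (ModuleCat.ofHom (d 0).rangeRestrict) (by
        ext x
        exact h0.apply_apply_eq_zero x)
    have hS : S.ShortExact := gor_ses _ _ hι (LinearMap.surjective_rangeRestrict _) (by
      intro x
      rw [← h0 x]
      simp [Subtype.ext_iff]) _
    have : Injective S.X₂ := (Module.injective_iff_injective_object R (I 0)).1 (hI 0)
    exact (hS.hasInjectiveDimensionLT_X₃_iff n ‹_›).mp h3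

lemma gor_ext_equiv {R : Type u} [CommRing R] {N N' : Type u} [AddCommGroup N] [Module R N]
    [AddCommGroup N'] [Module R N'] (e : N ≃ₗ[R] N') (M : ModuleCat.{u} R) (l : ℕ)
    (h : Subsingleton (Ext.{u} (ModuleCat.of R N) M l)) :
    Subsingleton (Ext.{u} (ModuleCat.of R N') M l) := by
  let i : ModuleCat.of R N' ≅ ModuleCat.of R N := e.symm.toModuleIso
  refine ⟨fun a b => ?_⟩
  have key : ∀ a : Ext.{u} (ModuleCat.of R N') M l, a = 0 := fun a => by
    have h1 : (Ext.mk₀ i.inv).comp a (zero_add l) = 0 := Subsingleton.elim _ _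
    have h2 : (Ext.mk₀ i.hom).comp ((Ext.mk₀ i.inv).comp a (zero_add l)) (zero_add l) = a := by
      rw [Ext.mk₀_comp_mk₀_assoc, i.hom_inv_id, Ext.mk₀_id_comp]
    rw [← h2, h1, Ext.comp_zero]
  rw [key a, key b]

lemma gor_ext_of_primes {R : Type u} [CommRing R] [IsNoetherianRing R] (M : ModuleCat.{u} R)
    (n : ℕ) (J : Ideal R)
    (h : ∀ q : Ideal R, q.IsPrime → J ≤ q → ∀ l, n ≤ l →
      Subsingleton (Ext.{u} (ModuleCat.of R (R ⧸ q)) M l))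
    (N : Type u) [AddCommGroup N] [Module R N] (hfin : Module.Finite R N)
    (hJ : J ≤ Module.annihilator R N) (l : ℕ) (hl : n ≤ l) :
    Subsingleton (Ext.{u} (ModuleCat.of R N) M l) := by
  revert hJ
  induction hfin using IsNoetherianRing.induction_on_isQuotientEquivQuotientPrime R with
  | subsingleton N =>
    intro _
    have hz : Limits.IsZero (ModuleCat.of R N) := ModuleCat.isZero_of_subsingleton _
    refine ⟨fun a b => ?_⟩
    have key : ∀ a : Ext.{u} (ModuleCat.of R N) M l, a = 0 := fun a => by
      rw [← Ext.mk₀_id_comp a, hz.eq_of_src (𝟙 _) 0, Ext.mk₀_zero, Ext.zero_comp]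
    rw [key a, key b]
  | quotient N q e =>
    intro hJ
    refine gor_ext_equiv e.symm M l (h q.1 q.2 ?_ l hl)
    rwa [e.annihilator_eq, Ideal.annihilator_quotient] at hJ
  | exact N₁ N₂ N₃ f g hf hg hfg h₁ h₃ =>
    intro hJ
    have h₁ := h₁ (hJ.trans (f.annihilator_le_of_injective hf))
    have h₃ := h₃ (hJ.trans (g.annihilator_le_of_surjective hg))
    have hS := gor_ses f g hf hg hfg (gor_ofHom_zero hfg)
    have key : ∀ a : Ext.{u} (ModuleCat.of R N₂) M l, a = 0 := fun a => by
      obtain ⟨x, hx⟩ := Ext.contravariant_sequence_exact₂ hS M a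
        (@Subsingleton.elim _ h₁ _ _)
      rw [← hx, @Subsingleton.elim _ h₃ x 0, Ext.comp_zero]
    exact ⟨fun a b => by rw [key a, key b]⟩

lemma gor_ext_divisible {R : Type u} [CommRing R] (N M : ModuleCat.{u} R) (x : R) (l : ℕ)
    (reg : IsSMulRegular N x)
    (hz : Subsingleton (Ext.{u} (N.smulShortComplex x).X₃ M (l + 1)))
    (y : Ext.{u} N M l) : ∃ z : Ext.{u} N M l, x • z = y := by
  have hS := reg.smulShortComplex_shortExact
  obtain ⟨z, hz⟩ := Ext.contravariant_sequence_exact₁ hS M y (n₁ := l + 1) (by omega)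
        (Subsingleton.elim _ _)
  refine ⟨z, ?_⟩
  rw [← hz]
  have h : ∀ z : Ext.{u} N M l, x • z = (Ext.mk₀ (x • 𝟙 N)).comp z (zero_add l) := fun z => by
    simp [Ext.mk₀_smul]
  exact h z

set_option maxHeartbeats 800000 in
open IsLocalRing Pointwise in
lemma gor_ext_of_residue {R : Type u} [CommRing R] [IsNoetherianRing R] [IsLocalRing R]
    (M : ModuleCat.{u} R) [Module.Finite R M] (n : ℕ)
    (h : ∀ l, n ≤ l → Subsingleton (Ext.{u} (ModuleCat.of R (R ⧸ maximalIdeal R)) M l))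
    (q : Ideal R) (hq : q.IsPrime) (l : ℕ) (hl : n ≤ l) :
    Subsingleton (Ext.{u} (ModuleCat.of R (R ⧸ q)) M l) := by
  induction q using WellFoundedGT.induction generalizing l with
  | ind p ih =>
    by_cases hp : p = maximalIdeal R
    · subst hp; exact h l hl
    obtain ⟨x, hxm, hxp⟩ : ∃ x ∈ maximalIdeal R, x ∉ p := by
      by_contra! hcon
      exact hp (le_antisymm (le_maximalIdeal hq.ne_top) hcon)
    have reg : IsSMulRegular (ModuleCat.of R (R ⧸ p)) x := by
      intro a b hab
      obtain ⟨a, rfl⟩ := Ideal.Quotient.mk_surjective a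
      obtain ⟨b, rfl⟩ := Ideal.Quotient.mk_surjective b
      have h1 : Ideal.Quotient.mk p (x * a) = Ideal.Quotient.mk p (x * b) := hab
      rw [Ideal.Quotient.eq, ← mul_sub] at h1
      exact Ideal.Quotient.eq.2 ((hq.mem_or_mem h1).resolve_left hxp)
    have hz : Subsingleton (Ext.{u} ((ModuleCat.of R (R ⧸ p)).smulShortComplex x).X₃ M (l + 1)) := by
      refine gor_ext_of_primes M n (p ⊔ Ideal.span {x}) (fun q hq' hle l hl => ih q ?_ hq' l hl)
        (QuotSMulTop x (R ⧸ p)) inferInstance ?_ (l + 1) (by omega)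
      · refine lt_of_le_of_ne (le_sup_left.trans hle) ?_
        rintro rfl
        exact hxp (hle (Ideal.mem_sup_right (Ideal.mem_span_singleton_self x)))
      · refine sup_le ?_ ?_
        · refine le_trans ?_ (LinearMap.annihilator_le_of_surjective
            (Submodule.mkQ (x • (⊤ : Submodule R (R ⧸ p)))) (Submodule.mkQ_surjective _))
          rw [Ideal.annihilator_quotient]
        · rw [Ideal.span_singleton_le_iff_mem, Module.mem_annihilator]
          intro m
          obtain ⟨m, rfl⟩ := Submodule.mkQ_surjective _ m
          rw [← map_smul, Submodule.mkQ_apply, Submodule.Quotient.mk_eq_zero]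
          exact Submodule.smul_mem_pointwise_smul _ _ _ trivial
    have htop : (⊤ : Submodule R (Ext.{u} (ModuleCat.of R (R ⧸ p)) M l)) = ⊥ := by
      have : Module.Finite R (ModuleCat.of R (R ⧸ p)) := inferInstanceAs (Module.Finite R (R ⧸ p))
      refine Submodule.eq_bot_of_le_smul_of_le_jacobson_bot (maximalIdeal R) _
        Module.Finite.fg_top ?_ (IsLocalRing.maximalIdeal_le_jacobson _)
      intro y _
      obtain ⟨z, hz⟩ := gor_ext_divisible _ M x l reg hz y
      rw [← hz]
      exact Submodule.smul_mem_smul hxm Submodule.mem_top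
    exact (Submodule.subsingleton_iff R).1 (subsingleton_of_bot_eq_top htop.symm)

open IsLocalRing Pointwise in
lemma gor_injDim_of_residue {R : Type u} [CommRing R] [IsNoetherianRing R] [IsLocalRing R]
    (M : ModuleCat.{u} R) [Module.Finite R M] (n : ℕ)
    (h : ∀ l, n + 1 ≤ l → Subsingleton (Ext.{u} (ModuleCat.of R (R ⧸ maximalIdeal R)) M l)) :
    HasInjectiveDimensionLE M n := by
  refine gor_injDim_of_ideals n M fun I => ?_
  exact gor_ext_of_primes M (n + 1) ⊥ (fun q hq _ l hl => gor_ext_of_residue M (n + 1) h q hq l hl)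
    (R ⧸ I) inferInstance bot_le (n + 1) le_rfl

open IsLocalRing RingTheory.Sequence in
lemma gor_exists_regular {R : Type u} [CommRing R] [IsNoetherianRing R] [IsLocalRing R]
    (d : ℕ) (hd : ringKrullDim R ≤ d) : ∃ rs : List R, IsRegular R rs ∧ rs.length ≤ d ∧
      ∃ f : (R ⧸ maximalIdeal R) →ₗ[R] (R ⧸ Ideal.ofList rs), Function.Injective f := by
  have hlen : ∀ rs : List R, IsRegular R rs → rs.length ≤ d := by
    intro rs h
    have h1 := ringKrullDim_add_length_eq_ringKrullDim_of_isRegular rs h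
    have hne : Ideal.ofList rs ≠ ⊤ := by
      have := h.2
      simpa [eq_comm] using this
    have : Nontrivial (R ⧸ Ideal.ofList rs) := Ideal.Quotient.nontrivial_iff.2 hne
    have h2 : 0 ≤ ringKrullDim (R ⧸ Ideal.ofList rs) := ringKrullDim_nonneg_of_nontrivial
    have h3 : ((rs.length : ℕ) : WithBot ℕ∞) ≤ (d : ℕ) := by
      refine le_trans ?_ hd
      rw [← h1]
      exact le_add_of_nonneg_left h2
    exact_mod_cast h3
  by_contra! hcon
  have key : ∀ t : ℕ, ∃ rs : List R, IsRegular R rs ∧ rs.length = t := by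
    intro t
    induction t with
    | zero => exact ⟨[], IsRegular.nil R R, rfl⟩
    | succ t ih =>
      obtain ⟨rs, hrs, hl⟩ := ih
      have hc := hcon rs hrs (hlen rs hrs)
      have hsub : Subsingleton ((R ⧸ maximalIdeal R) →ₗ[R] (R ⧸ Ideal.ofList rs)) := by
        have : IsSimpleModule R (R ⧸ maximalIdeal R) :=
          isSimpleModule_iff_isCoatom.2 (maximalIdeal.isMaximal R).out
        have key : ∀ f : (R ⧸ maximalIdeal R) →ₗ[R] (R ⧸ Ideal.ofList rs), f = 0 := fun f =>
          (LinearMap.injective_or_eq_zero f).resolve_left (hc f)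
        exact ⟨fun a b => by rw [key a, key b]⟩
      obtain ⟨x, hx, hreg⟩ := IsSMulRegular.subsingleton_linearMap_iff.1 hsub
      rw [Ideal.annihilator_quotient] at hx
      refine ⟨rs ++ [x], ?_, by simp [hl]⟩
      have hmem : ∀ r ∈ rs, r ∈ maximalIdeal R := by
        intro r hr
        refine IsLocalRing.le_maximalIdeal (J := Ideal.ofList rs) ?_
          (Ideal.subset_span hr)
        have := hrs.2
        simpa [eq_comm] using this
      refine ⟨(isWeaklyRegular_append_iff R rs [x]).2 ⟨hrs.1, ?_⟩, ?_⟩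
      · rw [isWeaklyRegular_singleton_iff]
        have e : (R ⧸ Ideal.ofList rs) ≃ₗ[R] (R ⧸ (Ideal.ofList rs • ⊤ : Submodule R R)) :=
          Submodule.quotEquivOfEq _ _ (by simp)
        exact (e.isSMulRegular_congr x).1 hreg
      · intro htop
        have hle : Ideal.ofList (rs ++ [x]) ≤ maximalIdeal R := by
          refine Ideal.span_le.2 ?_
          intro r hr
          simp at hr
          rcases hr with hr | rfl
          · exact hmem r hr
          · exact hx
        have : (⊤ : Ideal R) ≤ maximalIdeal R := by
          have h2 : Ideal.ofList (rs ++ [x]) • (⊤ : Submodule R R) = Ideal.ofList (rs ++ [x]) := by simp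
          rw [h2] at htop
          rw [htop]; exact hle
        exact (maximalIdeal.isMaximal R).ne_top (top_le_iff.1 this)
  obtain ⟨rs, h1, h2⟩ := key (d + 1)
  have := hlen rs h1
  omega

open IsLocalRing RingTheory.Sequence in
lemma gor_local_bound {R : Type u} [CommRing R] [IsNoetherianRing R] [IsLocalRing R]
    (d : ℕ) (hd : ringKrullDim R ≤ d) (n : ℕ)
    (h : HasInjectiveDimensionLE (ModuleCat.of R R) (d + n)) :
    HasInjectiveDimensionLE (ModuleCat.of R R) d := by
  induction n with
  | zero => exact h
  | succ n ih =>
    apply ih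
    have : Module.Finite R (ModuleCat.of R R) := inferInstanceAs (Module.Finite R R)
    refine gor_injDim_of_residue _ _ fun l hl => ?_
    rcases Nat.lt_or_ge l (d + n + 2) with hl2 | hl2
    · obtain rfl : l = d + n + 1 := by omega
      obtain ⟨rs, hreg, hlen, f, hf⟩ := gor_exists_regular d hd
      have hpd := ModuleCat.projectiveDimension_quotient_eq_length.{u} rs hreg
      have hex : Function.Exact f (Submodule.mkQ (LinearMap.range f)) := fun x => by
        rw [Submodule.mkQ_apply, Submodule.Quotient.mk_eq_zero]; rfl
      have hS := gor_ses f _ hf (Submodule.mkQ_surjective _) hex (gor_ofHom_zero hex)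
      have hpd2 : HasProjectiveDimensionLE
          (ModuleCat.of R (Shrink.{u} (R ⧸ Ideal.ofList rs))) rs.length :=
        (projectiveDimension_le_iff _ _).1 hpd.le
      have hsub : Subsingleton (Ext.{u} (ModuleCat.of R (R ⧸ Ideal.ofList rs))
          (ModuleCat.of R R) (d + n + 1)) := by
        refine gor_ext_equiv (Shrink.linearEquiv R _) _ _ ?_
        exact HasProjectiveDimensionLT.subsingleton _ (rs.length + 1) _ (by omega) _
      have key : ∀ a : Ext.{u} (ModuleCat.of R (R ⧸ maximalIdeal R)) (ModuleCat.of R R) (d + n + 1),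
          a = 0 := fun a => by
        have hs2 : ∀ Y : ModuleCat.{u} R, Subsingleton (Ext.{u} Y (ModuleCat.of R R) (d + n + 2)) :=
          fun Y => HasInjectiveDimensionLT.subsingleton (ModuleCat.of R R) (d + (n + 1) + 1) _
            (by omega) _
        obtain ⟨x, hx⟩ := Ext.contravariant_sequence_exact₁ hS (ModuleCat.of R R) a
          (n₁ := d + n + 2) (by omega) (@Subsingleton.elim _ (hs2 _) _ _)
        rw [← hx, @Subsingleton.elim _ hsub x 0, Ext.comp_zero]
      exact ⟨fun a b => by rw [key a, key b]⟩
    · exact HasInjectiveDimensionLT.subsingleton (ModuleCat.of R R) (d + (n + 1) + 1) _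
            (by omega) _

lemma gor_inj_finsupp {R : Type u} [CommRing R] [IsNoetherianRing R] (ι I : Type u)
    [AddCommGroup I] [Module R I] (hI : Module.Injective R I) : Module.Injective R (ι →₀ I) := by
  classical
  rw [← Module.Baer.iff_injective]
  intro J g
  have hB := Module.Baer.of_injective hI
  choose h hh using fun i => hB J ((Finsupp.lapply i).comp g)
  obtain ⟨s, hs⟩ := (inferInstance : Module.Finite R J)
  let T : Finset ι := s.biUnion fun x => (g x).support
  have hT : ∀ x, g x ∈ Finsupp.supported I R (T : Set ι) := by
    intro x
    have : (⊤ : Submodule R J) ≤ (Finsupp.supported I R (T : Set ι)).comap g := by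
      rw [← hs, Submodule.span_le]
      intro y hy
      change g y ∈ Finsupp.supported I R (T : Set ι)
      rw [Finsupp.mem_supported]
      intro i hi
      exact Finset.mem_coe.2 (Finset.mem_biUnion.2 ⟨y, hy, hi⟩)
    exact this trivial
  refine ⟨∑ i ∈ T, (Finsupp.lsingle i).comp (h i), fun x hx => ?_⟩
  ext i
  have h1 := hh i x hx
  simp only [LinearMap.comp_apply, Finsupp.lapply_apply] at h1
  rw [← h1]
  simp only [LinearMap.sum_apply, LinearMap.comp_apply, Finsupp.lsingle_apply,
    Finsupp.finsetSum_apply, Finsupp.single_apply]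
  rw [Finset.sum_ite_eq' T i]
  split_ifs with hi
  · rfl
  · rw [h1]
    have := hT ⟨x, hx⟩
    rw [Finsupp.mem_supported'] at this
    exact (this i hi).symm

def GorHE {A : Type u} [CommRing A] (X : ℤ → Type u) [∀ n, AddCommGroup (X n)]
    [∀ n, Module A (X n)] (d : ∀ n, X n →ₗ[A] X (n + 1))
    (Q : Type u) [AddCommGroup Q] [Module A Q] : Prop :=
  ∀ n (f : X (n + 1) →ₗ[A] Q), f.comp (d n) = 0 →
    ∃ g : X (n + 1 + 1) →ₗ[A] Q, g.comp (d (n + 1)) = f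

section
variable {A : Type u} [CommRing A] {X : ℤ → Type u} [∀ n, AddCommGroup (X n)]
    [∀ n, Module A (X n)] {d : ∀ n, X n →ₗ[A] X (n + 1)}

lemma gor_HE_inj (hex : ∀ n, Function.Exact (d n) (d (n + 1)))
    {Q : Type u} [AddCommGroup Q] [Module A Q] (hQ : Module.Injective A Q) : GorHE X d Q := by
  intro n f hf
  have hle : LinearMap.ker (d (n + 1)) ≤ LinearMap.ker f := by
    intro x hx
    obtain ⟨y, rfl⟩ := (hex n x).1 hx
    exact congr($hf y)
  obtain ⟨h, hh⟩ := Module.Injective.extension_property A Q _ _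
    ((LinearMap.ker (d (n + 1))).liftQ (d (n + 1)) le_rfl)
    (LinearMap.ker_eq_bot.1 (Submodule.ker_liftQ_eq_bot _ _ _ le_rfl))
    ((LinearMap.ker (d (n + 1))).liftQ f hle)
  refine ⟨h, ?_⟩
  ext x
  have := congr($hh (Submodule.Quotient.mk x))
  simpa using this

lemma gor_HE_step (hex : ∀ n, Function.Exact (d n) (d (n + 1)))
    (hP : ∀ n, Module.Projective A (X n))
    {M I N : Type u} [AddCommGroup M] [Module A M] [AddCommGroup I] [Module A I]
    [AddCommGroup N] [Module A N] (i : M →ₗ[A] I) (p : I →ₗ[A] N) (hi : Function.Injective i)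
    (hp : Function.Surjective p) (hip : Function.Exact i p) (hI : GorHE X d I)
    (hN : GorHE X d N) : GorHE X d M := by
  intro n f hf
  obtain ⟨g, hg⟩ := hI n (i.comp f) (by rw [LinearMap.comp_assoc, hf, LinearMap.comp_zero])
  obtain ⟨h, hh⟩ := hN (n + 1) (p.comp g) (by
    rw [LinearMap.comp_assoc, hg, ← LinearMap.comp_assoc, hip.linearMap_comp_eq_zero,
      LinearMap.zero_comp])
  obtain ⟨h', hh'⟩ := Module.projective_lifting_property p h hp
  have hdd : (d (n + 1 + 1)).comp (d (n + 1)) = 0 := (hex (n + 1)).linearMap_comp_eq_zero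
  let g' := g - h'.comp (d (n + 1 + 1))
  have hg' : ∀ x, ∃ m, i m = g' x := fun x => (hip _).1 (by
    simp only [g', LinearMap.sub_apply, map_sub, LinearMap.comp_apply]
    have h1 := congr($hh x)
    have h2 := congr($hh' (d (n + 1 + 1) x))
    simp only [LinearMap.comp_apply] at h1 h2
    rw [h2, h1, sub_self])
  let e := LinearEquiv.ofInjective i hi
  refine ⟨e.symm.toLinearMap.comp (g'.codRestrict (LinearMap.range i) hg'), ?_⟩
  ext x
  apply hi
  have h3 : ∀ y, i (e.symm y) = y := fun y => congrArg Subtype.val (e.apply_symm_apply y)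
  simp only [LinearMap.comp_apply, LinearEquiv.coe_coe]
  rw [h3]
  change g (d (n + 1) x) - h' (d (n + 1 + 1) (d (n + 1) x)) = i (f x)
  have h4 : d (n + 1 + 1) (d (n + 1) x) = 0 := congr($hdd x)
  rw [h4, map_zero, sub_zero]
  exact congr($hg x)

lemma gor_HE_finsupp [IsNoetherianRing A] (hex : ∀ n, Function.Exact (d n) (d (n + 1)))
    (hP : ∀ n, Module.Projective A (X n)) (ι : Type u)
    (M : Type u) [AddCommGroup M] [Module A M] (n : ℕ)
    (h : HasInjectiveDimensionLE (ModuleCat.of A M) n) : GorHE X d (ι →₀ M) := by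
  induction n generalizing M with
  | zero =>
    rw [HasInjectiveDimensionLE, zero_add, ← injective_iff_hasInjectiveDimensionLT_one,
      ← Module.injective_iff_injective_object] at h
    exact gor_HE_inj hex (gor_inj_finsupp ι M h)
  | succ n ih =>
    obtain ⟨I, _, _, f, hI, hf⟩ := gor_exists_inj (R := A) M
    let N := I ⧸ LinearMap.range f
    let π : I →ₗ[A] N := Submodule.mkQ _
    have hπ : Function.Surjective π := Submodule.mkQ_surjective _
    have hex' : Function.Exact f π := fun x => by
      rw [Submodule.mkQ_apply, Submodule.Quotient.mk_eq_zero]; rfl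
    have hS := gor_ses f π hf (Submodule.mkQ_surjective _) hex' (gor_ofHom_zero hex')
    have hinj : Injective (ModuleCat.of A I) := (Module.injective_iff_injective_object A I).1 hI
    have h3 := (hS.hasInjectiveDimensionLT_X₃_iff n hinj).mpr h
    refine gor_HE_step hex hP (Finsupp.mapRange.linearMap f) (Finsupp.mapRange.linearMap π)
      (Finsupp.mapRange_injective _ (map_zero f) hf) (Finsupp.mapRange_surjective _ (map_zero π) hπ) ?_
      (gor_HE_inj hex (gor_inj_finsupp ι I hI)) (ih N h3)
    rw [LinearMap.exact_iff, Finsupp.ker_mapRange, Finsupp.range_mapRange_linearMap _ (LinearMap.ker_eq_bot.2 hf),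
      LinearMap.exact_iff.1 hex']

lemma gor_HE_proj [IsNoetherianRing A] (hex : ∀ n, Function.Exact (d n) (d (n + 1)))
    (hP : ∀ n, Module.Projective A (X n)) (n : ℕ)
    (h : HasInjectiveDimensionLE (ModuleCat.of A A) n)
    (Q : Type u) [AddCommGroup Q] [Module A Q] (hQ : Module.Projective A Q) : GorHE X d Q := by
  obtain ⟨s, hs⟩ := Module.projective_def'.1 hQ
  intro n f hf
  obtain ⟨g, hg⟩ := gor_HE_finsupp hex hP Q A _ h n (s.comp f)
    (by rw [LinearMap.comp_assoc, hf, LinearMap.comp_zero])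
  refine ⟨(Finsupp.linearCombination A id).comp g, ?_⟩
  rw [LinearMap.comp_assoc, hg, ← LinearMap.comp_assoc, hs, LinearMap.id_comp]

end

lemma gor_forward_injDim (A : Type u) [CommRing A] [IsNoetherianRing A] (hdim : ringKrullDim A < ⊤)
    (hG : IsGorensteinRing A) : ∃ n, HasInjectiveDimensionLE (ModuleCat.of A A) n := by
  obtain ⟨d, hd⟩ : ∃ d : ℕ, ringKrullDim A ≤ d := by
    induction h : ringKrullDim A with
    | bot => exact ⟨0, bot_le⟩
    | coe x =>
      rw [h] at hdim
      have : x ≠ ⊤ := by rintro rfl; exact lt_irrefl _ hdim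
      lift x to ℕ using this
      exact ⟨x, le_rfl⟩
  refine ⟨d, ?_⟩
  rw [ModuleCat.hasInjectiveDimensionLE_iff_forall_primeSpectrum d (ModuleCat.of A A)]
  intro p
  obtain ⟨n, I, _, _, ι, δ, hI, hι, h0, hδ, hn⟩ := hG p.asIdeal p.isPrime
  have h1 := gor_of_finite _ n I ι δ hI hι h0 hδ hn
  have h2 : HasInjectiveDimensionLE (ModuleCat.of (Localization.AtPrime p.asIdeal)
      (Localization.AtPrime p.asIdeal)) (d + n) :=
    hasInjectiveDimensionLT_of_ge _ (n + 1) (d + n + 1) (by omega)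
  have hdp : ringKrullDim (Localization.AtPrime p.asIdeal) ≤ d := by
    rw [IsLocalization.AtPrime.ringKrullDim_eq_height p.asIdeal]
    exact (Ideal.height_le_ringKrullDim_of_ne_top p.isPrime.ne_top).trans hd
  have h3 := gor_local_bound d hdp n h2
  let S := p.asIdeal.primeCompl
  let f : ModuleCat.of A A →ₗ[A] Localization.AtPrime p.asIdeal :=
    Algebra.linearMap A (Localization.AtPrime p.asIdeal)
  have i1 : IsLocalizedModule S f :=
    inferInstanceAs (IsLocalizedModule S (Algebra.linearMap A (Localization S)))
  have i2 := ModuleCat.localizedModule_isLocalizedModule (ModuleCat.of A A) S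
  let e := IsLocalizedModule.linearEquiv S f ((ModuleCat.of A A).localizedModuleMkLinearMap S)
  exact (ModuleCat.hasInjectiveDimensionLE_iff_of_linearEquiv
    (e.extendScalarsOfIsLocalization S (Localization.AtPrime p.asIdeal)) d).1 h3

theorem gor_forward (A : Type u) [CommRing A] [IsNoetherianRing A] (hdim : ringKrullDim A < ⊤)
    (hG : IsGorensteinRing A) (X : ℤ → Type u) [∀ n, AddCommGroup (X n)] [∀ n, Module A (X n)]
    (d : ∀ n, X n →ₗ[A] X (n + 1)) (hP : ∀ n, Module.Projective A (X n))
    (hex : ∀ n, Function.Exact (d n) (d (n + 1))) : IsTotallyAcyclic A X d := by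
  obtain ⟨n, hn⟩ := gor_forward_injDim A hdim hG
  refine ⟨hex, fun Q _ _ hQ m f => ⟨fun hf => ?_, ?_⟩⟩
  · obtain ⟨g, hg⟩ := gor_HE_proj hex hP n hn Q hQ m f hf
    exact ⟨g, hg⟩
  · rintro ⟨g, rfl⟩
    change (g.comp (d (m + 1))).comp (d m) = 0
    rw [LinearMap.comp_assoc, (hex m).linearMap_comp_eq_zero, LinearMap.comp_zero]

/-- degree `j` part -/
def gorP {S : Type} (A : Type u) [CommRing A] (deg : S → ℕ) (j : ℕ) : Submodule A (S →₀ A) :=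
  Finsupp.supported A A {s | deg s = j}

lemma gor_ext_supp {S : Type} {A : Type u} [CommRing A] {T : Type u} [AddCommGroup T] [Module A T]
    (L L' : (S →₀ A) →ₗ[A] T) (U : Set S)
    (h : ∀ s ∈ U, L (Finsupp.single s 1) = L' (Finsupp.single s 1))
    (p : S →₀ A) (hp : p ∈ Finsupp.supported A A U) : L p = L' p := by
  rw [Finsupp.supported_eq_span_single] at hp
  have : Submodule.span A ((fun i => Finsupp.single i (1 : A)) '' U) ≤ LinearMap.eqLocus L L' := by
    rw [Submodule.span_le]
    rintro _ ⟨s, hs, rfl⟩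
    exact h s hs
  exact this hp

lemma gor_mem_supp {S : Type} {A : Type u} [CommRing A] {T : Type u} [AddCommGroup T] [Module A T]
    (L : (S →₀ A) →ₗ[A] T) (U : Set S) (N : Submodule A T)
    (h : ∀ s ∈ U, L (Finsupp.single s 1) ∈ N)
    (p : S →₀ A) (hp : p ∈ Finsupp.supported A A U) : L p ∈ N := by
  rw [Finsupp.supported_eq_span_single] at hp
  have : Submodule.span A ((fun i => Finsupp.single i (1 : A)) '' U) ≤ N.comap L := by
    rw [Submodule.span_le]
    rintro _ ⟨s, hs, rfl⟩
    exact h s hs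
  exact this hp

lemma gor_gen {S : Type} {A : Type u} [CommRing A] (deg : S → ℕ)
    (D : (S →₀ A) →ₗ[A] (S →₀ A))
    (hD : ∀ s, D (Finsupp.single s 1) ∈ Finsupp.supported A A {t | deg t < deg s})
    {T : Type u} [AddCommGroup T] [Module A T] (Good : S → T → T → Prop)
    (h : ∀ (s : S) (L : (S →₀ A) →ₗ[A] T),
      (∀ t, deg t < deg s → Good t (L (Finsupp.single t 1)) (L (D (Finsupp.single t 1)))) →
      ∃ x, Good s x (L (D (Finsupp.single s 1)))) :
    ∃ L : (S →₀ A) →ₗ[A] T, ∀ s, Good s (L (Finsupp.single s 1)) (L (D (Finsupp.single s 1))) := by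
  classical
  choose! F hF using h
  let M : ℕ → ((S →₀ A) →ₗ[A] T) := fun j => Nat.rec 0
    (fun j Mj => Finsupp.linearCombination A
      (fun s => if deg s < j then Mj (Finsupp.single s 1) else F s Mj)) j
  have M1 : ∀ j s, M (j + 1) (Finsupp.single s 1) =
      if deg s < j then M j (Finsupp.single s 1) else F s (M j) := by
    intro j s
    change Finsupp.linearCombination A _ _ = _
    rw [Finsupp.linearCombination_single, one_smul]
  have M2 : ∀ j p, p ∈ Finsupp.supported A A {t | deg t < j} → M (j + 1) p = M j p := by
    intro j p hp
    refine gor_ext_supp _ _ _ (fun s hs => ?_) p hp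
    rw [M1, if_pos (show deg s < j from hs)]
  have M3 : ∀ j k, ∀ s, deg s < j → M (j + k) (Finsupp.single s 1) = M j (Finsupp.single s 1) := by
    intro j k s hs
    induction k with
    | zero => rfl
    | succ k ih => rw [← add_assoc, M1, if_pos (by omega), ih]
  have M4 : ∀ j s, deg s < j → Good s (M j (Finsupp.single s 1)) (M j (D (Finsupp.single s 1))) := by
    intro j
    induction j with
    | zero => intro s hs; omega
    | succ j ih =>
      intro s hs
      have hD' : D (Finsupp.single s 1) ∈ Finsupp.supported A A {t | deg t < j} :=
        Finsupp.supported_mono (fun t ht => by simp at ht ⊢; omega) (hD s)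
      rw [M1, M2 _ _ hD']
      split_ifs with hj
      · exact ih s hj
      · exact hF s _ (fun t ht => ih t (by omega))
  let L := Finsupp.linearCombination A (fun s => M (deg s + 1) (Finsupp.single s 1))
  have L1 : ∀ j p, p ∈ Finsupp.supported A A {t | deg t < j} → L p = M j p := by
    intro j p hp
    refine gor_ext_supp _ _ _ (fun s hs => ?_) p hp
    simp only [L, Finsupp.linearCombination_single, one_smul]
    obtain ⟨k, rfl⟩ := Nat.exists_eq_add_of_lt hs
    rw [add_right_comm, M3 _ k s (by omega)]
  refine ⟨L, fun s => ?_⟩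
  rw [L1 (deg s + 1) (Finsupp.single s 1) (Finsupp.single_mem_supported _ _ (by simp)),
    L1 (deg s + 1) (D (Finsupp.single s 1))
      (Finsupp.supported_mono (fun t ht => by simp at ht ⊢; omega) (hD s))]
  exact M4 (deg s + 1) s (by omega)

/-- resolution package -/
structure GorRes (A : Type u) [CommRing A] (m : Ideal A) (S : Type) (deg : S → ℕ) (s0 : S)
    (D : (S →₀ A) →ₗ[A] (S →₀ A)) : Prop where
  fin : ∀ j, {s | deg s = j}.Finite
  deg0 : ∀ s, deg s = 0 ↔ s = s0
  hD0 : D (Finsupp.single s0 1) = 0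
  hDs : ∀ s j, deg s = j + 1 → D (Finsupp.single s 1) ∈ gorP A deg j
  DD : ∀ p, D (D p) = 0
  cyc : ∀ j, ∀ p ∈ gorP A deg (j + 1), D p = 0 → ∃ p' ∈ gorP A deg (j + 2), D p' = p
  bd : ∀ a ∈ m, ∃ p ∈ gorP A deg 1, D p = Finsupp.single s0 a
  bd' : ∀ p, D p s0 ∈ m

noncomputable def gorEps {S : Type} (A : Type u) [CommRing A] (deg : S → ℕ) :
    (S →₀ A) →ₗ[A] (S →₀ A) :=
  Finsupp.linearCombination A (fun s => Finsupp.single s ((-1 : A) ^ deg s))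

namespace GorRes
variable {A : Type u} [CommRing A] {m : Ideal A} {S : Type} {deg : S → ℕ} {s0 : S}
    {D : (S →₀ A) →ₗ[A] (S →₀ A)}

lemma eps_of_mem {j : ℕ} {p : S →₀ A} (hp : p ∈ gorP A deg j) : gorEps A deg p = (-1 : A) ^ j • p := by
  refine gor_ext_supp (gorEps A deg) ((-1 : A) ^ j • LinearMap.id) _ (fun s hs => ?_) p hp
  obtain rfl : deg s = j := hs
  simp [gorEps, Finsupp.linearCombination_single]

lemma single_mem (s : S) (a : A) : Finsupp.single s a ∈ gorP A deg (deg s) :=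
  Finsupp.single_mem_supported _ _ rfl

lemma eps_eps (p : S →₀ A) : gorEps A deg (gorEps A deg p) = p := by
  have : (gorEps A deg).comp (gorEps A deg) = LinearMap.id := by
    ext s : 2
    simp only [LinearMap.comp_apply, Finsupp.lsingle_apply, LinearMap.id_apply]
    rw [eps_of_mem (single_mem s 1), map_smul, eps_of_mem (single_mem s 1), smul_smul, ← mul_pow]
    simp
  exact congr($this p)

variable (hR : GorRes A m S deg s0 D)
include hR

lemma hD (s : S) : D (Finsupp.single s 1) ∈ Finsupp.supported A A {t | deg t < deg s} := by
  rcases h : deg s with _ | j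
  · rw [(hR.deg0 s).1 h, hR.hD0]; exact zero_mem _
  · exact Finsupp.supported_mono (fun t ht => by simp at ht ⊢; omega) (hR.hDs s j h)

lemma D_mem {j : ℕ} {p : S →₀ A} (hp : p ∈ gorP A deg (j + 1)) : D p ∈ gorP A deg j :=
  gor_mem_supp D _ _ (fun s hs => hR.hDs s j hs) p hp

lemma D_zero {p : S →₀ A} (hp : p ∈ gorP A deg 0) : D p = 0 :=
  gor_ext_supp D 0 _ (fun s hs => by rw [(hR.deg0 s).1 hs, hR.hD0]; rfl) p hp

lemma eps_D (p : S →₀ A) : gorEps A deg (D p) = - D (gorEps A deg p) := by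
  have : (gorEps A deg).comp D = - D.comp (gorEps A deg) := by
    ext s : 2
    simp only [LinearMap.comp_apply, Finsupp.lsingle_apply, LinearMap.neg_apply]
    rw [eps_of_mem (single_mem s 1), map_smul]
    rcases h : deg s with _ | j
    · rw [(hR.deg0 s).1 h, hR.hD0]; simp
    · rw [eps_of_mem (hR.hDs s j h), pow_succ]; simp
  exact congr($this p)

lemma mem_zero {p : S →₀ A} (hp : p ∈ gorP A deg 0) : p = Finsupp.single s0 (p s0) := by
  ext s
  by_cases h : s = s0
  · subst h; simp
  · rw [Finsupp.single_eq_of_ne h]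
    exact (Finsupp.mem_supported' _ _).1 hp s (fun hs => h ((hR.deg0 s).1 hs))

lemma nullhomotopy (e : ℕ) (Y : (S →₀ A) →ₗ[A] (S →₀ A))
    (hY : ∀ s, Y (Finsupp.single s 1) ∈ gorP A deg (deg s + e))
    (hDY : ∀ p, D (Y p) = - Y (D p))
    (h0 : e = 0 → Y (Finsupp.single s0 1) s0 ∈ m) :
    ∃ L : (S →₀ A) →ₗ[A] (S →₀ A),
      (∀ s, L (Finsupp.single s 1) ∈ gorP A deg (deg s + e + 1)) ∧
      ∀ p, D (L p) - L (D p) = Y p := by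
  obtain ⟨L, hL⟩ := gor_gen deg D hR.hD
    (fun s x y => x ∈ gorP A deg (deg s + e + 1) ∧ D x = Y (Finsupp.single s 1) + y) (by
      intro s L hL
      rcases h : deg s with _ | b
      · obtain rfl := (hR.deg0 s).1 h
        simp only [hR.hD0, map_zero, add_zero]
        have hYs := hY s
        rw [h] at hYs
        rcases e with _ | e
        · obtain ⟨p, hp, hp'⟩ := hR.bd _ (h0 rfl)
          refine ⟨p, hp, ?_⟩
          rw [hp', ← hR.mem_zero hYs]
        · rw [zero_add] at hYs
          obtain ⟨p, hp, hp'⟩ := hR.cyc e _ hYs (by rw [hDY, hR.hD0]; simp)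
          refine ⟨p, ?_, hp'⟩
          convert hp using 2
          ring
      · have hds := hR.hDs s b h
        have hYs := hY s
        rw [h, show b + 1 + e = (b + e) + 1 by ring] at hYs
        have h1 : L (D (Finsupp.single s 1)) ∈ gorP A deg (b + e + 1) :=
          gor_mem_supp L _ _ (fun t ht => by
            have ht : deg t = b := ht
            have := (hL t (by omega)).1
            rwa [ht] at this) _ hds
        have h2 : D (L (D (Finsupp.single s 1))) =
            Y (D (Finsupp.single s 1)) + L (D (D (Finsupp.single s 1))) :=
          gor_ext_supp (D.comp L) (Y + L.comp D) _ (fun t ht => by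
            have ht : deg t = b := ht
            exact (hL t (by omega)).2) _ hds
        obtain ⟨p, hp, hp'⟩ := hR.cyc (b + e) _ (add_mem hYs h1) (by
          rw [map_add, h2, hDY, hR.DD]; simp)
        refine ⟨p, ?_, hp'⟩
        convert hp using 2
        ring)
  refine ⟨L, fun s => (hL s).1, fun p => ?_⟩
  have : D.comp L - L.comp D = Y := by
    ext s : 2
    simp only [LinearMap.comp_apply, Finsupp.lsingle_apply, LinearMap.sub_apply]
    rw [(hL s).2, add_sub_cancel_right]
  exact congr($this p)

lemma exists_L : ∃ L : (S →₀ A) →ₗ[A] ((S →₀ A) →ₗ[A] (S →₀ A)),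
    L (Finsupp.single s0 1) = LinearMap.id ∧
    (∀ s t, L (Finsupp.single s 1) (Finsupp.single t 1) ∈ gorP A deg (deg t + deg s)) ∧
    ∀ p q, D (L p q) - L p (D q) = L (D p) (gorEps A deg q) := by
  obtain ⟨L, hL⟩ := gor_gen deg D hR.hD
    (T := (S →₀ A) →ₗ[A] (S →₀ A))
    (fun s x y => (s = s0 → x = LinearMap.id) ∧
      (∀ t, x (Finsupp.single t 1) ∈ gorP A deg (deg t + deg s)) ∧
      ∀ q, D (x q) - x (D q) = y (gorEps A deg q)) (by
    intro s L hL
    rcases h : deg s with _ | j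
    · obtain rfl := (hR.deg0 s).1 h
      refine ⟨LinearMap.id, fun _ => rfl, fun t => single_mem t 1, fun q => ?_⟩
      rw [hR.hD0]; simp
    · have hds := hR.hDs s j h
      have hL3 : ∀ q, D (L (D (Finsupp.single s 1)) q) = L (D (Finsupp.single s 1)) (D q) := by
        intro q
        have := gor_ext_supp (D.comp (LinearMap.applyₗ q ∘ₗ L))
          ((LinearMap.applyₗ (D q)).comp L +
            ((LinearMap.applyₗ (gorEps A deg q)).comp L).comp D) _ (fun t ht => by
            have ht : deg t = j := ht
            have := (hL t (by omega)).2.2 q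
            rw [sub_eq_iff_eq_add'] at this
            exact this) _ hds
        simp only [LinearMap.comp_apply, LinearMap.add_apply, LinearMap.applyₗ_apply_apply,
          hR.DD, map_zero, LinearMap.zero_apply, add_zero] at this
        exact this
      obtain ⟨x, hx1, hx2⟩ := hR.nullhomotopy j
        ((L (D (Finsupp.single s 1))).comp (gorEps A deg)) (by
          intro t
          rw [LinearMap.comp_apply, eps_of_mem (single_mem t 1), map_smul]
          refine Submodule.smul_mem _ _ ?_
          exact gor_mem_supp ((LinearMap.applyₗ (Finsupp.single t 1)).comp L) _ _ (fun t' ht => by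
            have ht : deg t' = j := ht
            have := (hL t' (by omega)).2.1 t
            rwa [ht] at this) _ hds) (by
          intro p
          rw [LinearMap.comp_apply, LinearMap.comp_apply, hL3, hR.eps_D, map_neg, neg_neg]) (by
          rintro rfl
          rw [hR.mem_zero hds, ← mul_one (D (Finsupp.single s 1) s0), ← smul_eq_mul,
            ← Finsupp.smul_single, map_smul, (hL s0 (by rw [(hR.deg0 s0).2 rfl]; omega)).1 rfl,
            LinearMap.comp_apply, eps_of_mem (single_mem s0 1), (hR.deg0 s0).2 rfl]
          simpa using hR.bd' _)
      refine ⟨x, ?_, hx1, hx2⟩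
      rintro rfl
      rw [(hR.deg0 s).2 rfl] at h
      omega)
  refine ⟨L, (hL s0).1 rfl, fun s => (hL s).2.1, fun p q => ?_⟩
  have : D.comp (LinearMap.applyₗ q ∘ₗ L) - (LinearMap.applyₗ (D q)).comp L =
            ((LinearMap.applyₗ (gorEps A deg q)).comp L).comp D := by
    ext s : 2
    exact (hL s).2.2 q
  exact congr($this p)

end GorRes

lemma gor_vector_basis {A : Type u} [CommRing A] (m : Ideal A) [hm : m.IsMaximal]
    (H : Type u) [AddCommGroup H] [Module A H] (hH : ∀ a ∈ m, ∀ h : H, a • h = 0) :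
    ∃ (V : Type u) (b : V → H), (∀ h, ∃ c : V →₀ A, Finsupp.linearCombination A b c = h) ∧
      ∀ c : V →₀ A, Finsupp.linearCombination A b c = 0 → ∀ v, c v ∈ m := by
  let _ : Field (A ⧸ m) := Ideal.Quotient.field m
  have ht : Module.IsTorsionBySet A H (m : Set A) := fun h a => hH a.1 a.2 h
  let _ : Module (A ⧸ m) H := ht.module
  have hsmul : ∀ (a : A) (h : H), Ideal.Quotient.mk m a • h = a • h := fun a h => rfl
  let b := Module.Basis.ofVectorSpace (A ⧸ m) H
  have key : ∀ c : _ →₀ A, Finsupp.linearCombination A b c =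
      Finsupp.linearCombination (A ⧸ m) b (c.mapRange (Ideal.Quotient.mk m) (map_zero _)) := by
    intro c
    induction c using Finsupp.induction_linear with
    | zero => simp
    | add f g hf hg =>
      rw [map_add, hf, hg, Finsupp.mapRange_add (fun x y => map_add _ x y), map_add]
    | single v a =>
      rw [Finsupp.mapRange_single, Finsupp.linearCombination_single,
        Finsupp.linearCombination_single, hsmul]
  refine ⟨_, b, fun h => ?_, fun c hc v => ?_⟩
  · obtain ⟨c, hc⟩ := Finsupp.mapRange_surjective (Ideal.Quotient.mk m) (map_zero _)
      Ideal.Quotient.mk_surjective (b.repr h)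
    refine ⟨c, ?_⟩
    rw [key, hc, b.linearCombination_repr]
  · rw [key] at hc
    have h2 := (linearIndependent_iff.1 b.linearIndependent) _ hc
    have h3 := congr($h2 v)
    simpa [Ideal.Quotient.eq_zero_iff_mem] using h3

lemma gor_homology_basis {A : Type u} [CommRing A] (m : Ideal A) [hm : m.IsMaximal]
    {X : Type u} [AddCommGroup X] [Module A X] (dX : X →ₗ[A] X)
    (hX : ∀ a ∈ m, ∀ z, dX z = 0 → ∃ y, dX y = a • z) :
    ∃ (V : Type u) (f : V → X), (∀ v, dX (f v) = 0) ∧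
      (∀ x, dX x = 0 → ∃ (c : V →₀ A) (y : X), x = dX y + Finsupp.linearCombination A f c) ∧
      (∀ c : V →₀ A, (∃ y, dX y = Finsupp.linearCombination A f c) → ∀ v, c v ∈ m) := by
  let Z := LinearMap.ker dX
  let B : Submodule A Z := (LinearMap.range dX).comap Z.subtype
  obtain ⟨V, b, hspan, hind⟩ := gor_vector_basis m (Z ⧸ B) (by
    intro a ha h
    obtain ⟨z, rfl⟩ := Submodule.mkQ_surjective _ h
    rw [← map_smul, Submodule.mkQ_apply, Submodule.Quotient.mk_eq_zero]
    exact hX a ha z.1 z.2)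
  choose f hf using fun v => Submodule.mkQ_surjective B (b v)
  have hlc : ∀ c : V →₀ A, Finsupp.linearCombination A b c =
      B.mkQ (Finsupp.linearCombination A f c) := by
    intro c
    rw [Finsupp.linearCombination_apply, Finsupp.linearCombination_apply, map_finsuppSum]
    refine Finsupp.sum_congr fun v _ => ?_
    rw [map_smul, hf]
  have hlc2 : ∀ c : V →₀ A, (Finsupp.linearCombination A f c).1 =
      Finsupp.linearCombination A (fun v => (f v).1) c := by
    intro c
    change Z.subtype _ = _
    rw [Finsupp.linearCombination_apply, Finsupp.linearCombination_apply, map_finsuppSum]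
    rfl
  refine ⟨V, fun v => (f v).1, fun v => (f v).2, ?_, ?_⟩
  · intro x hx
    obtain ⟨c, hc⟩ := hspan (B.mkQ ⟨x, hx⟩)
    rw [hlc, eq_comm, ← sub_eq_zero, ← map_sub, Submodule.mkQ_apply,
      Submodule.Quotient.mk_eq_zero] at hc
    obtain ⟨y, hy⟩ := hc
    refine ⟨c, y, ?_⟩
    rw [hy, ← hlc2]
    simp
  · rintro c ⟨y, hy⟩
    refine hind c ?_
    rw [hlc, Submodule.mkQ_apply, Submodule.Quotient.mk_eq_zero]
    refine ⟨y, hy.trans (hlc2 c).symm⟩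

lemma gor_cone {A : Type u} [CommRing A] (m : Ideal A)
    (hTA : ∀ (F : Type u) [AddCommGroup F] [Module A F] (E : F →ₗ[A] F),
      Module.Projective A F → Function.Exact E E → ∀ G : F →ₗ[A] A, G.comp E = 0 →
        ∃ G' : F →ₗ[A] A, G'.comp E = G)
    {X P V : Type u} [AddCommGroup X] [Module A X] [AddCommGroup P] [Module A P]
    [Module.Projective A X] [Module.Projective A P]
    (dX : X →ₗ[A] X) (D : P →ₗ[A] P) (e0 : P) (c0 : P →ₗ[A] A) (f : V → X) (φ : V → P →ₗ[A] X)
    (dXdX : ∀ x, dX (dX x) = 0) (DD : ∀ p, D (D p) = 0) (De0 : D e0 = 0)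
    (φ0 : ∀ v, φ v e0 = f v) (φD : ∀ v p, φ v (D p) = dX (φ v p))
    (hdec : ∀ p, D p = 0 → ∃ p', p = D p' + c0 p • e0)
    (bd : ∀ a ∈ m, ∃ p, D p = a • e0)
    (hspan' : ∀ x, dX x = 0 → ∃ (c : V →₀ A) (y : X), x = dX y + Finsupp.linearCombination A f c)
    (hind' : ∀ c : V →₀ A, (∃ y, dX y = Finsupp.linearCombination A f c) → ∀ v, c v ∈ m)
    (v0 : V) (g : P →ₗ[A] A) (hg : g.comp D = 0) :
    ∃ (G1 : X →ₗ[A] A) (G2 : P →ₗ[A] A), ∀ p, g p = G1 (φ v0 p) + G2 (D p) := by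
  let Φ : (V →₀ P) →ₗ[A] X := Finsupp.lsum A φ
  have Φ_single : ∀ v p, Φ (Finsupp.single v p) = φ v p := fun v p => by
    simp [Φ]
  let DQ : (V →₀ P) →ₗ[A] (V →₀ P) := Finsupp.mapRange.linearMap D
  have DQ_single : ∀ v p, DQ (Finsupp.single v p) = Finsupp.single v (D p) := fun v p => by
    simp [DQ]
  have DQ_apply : ∀ q v, DQ q v = D (q v) := fun q v => rfl
  have ΦDQ : ∀ q, Φ (DQ q) = dX (Φ q) := by
    intro q
    have : Φ.comp DQ = dX.comp Φ := by
      refine Finsupp.lhom_ext fun v p => ?_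
      simp only [LinearMap.comp_apply]
      rw [DQ_single, Φ_single, Φ_single, φD]
    exact congr($this q)
  let ins : (V →₀ A) →ₗ[A] (V →₀ P) := Finsupp.mapRange.linearMap (LinearMap.toSpanSingleton A P e0)
  have ins_apply : ∀ c v, ins c v = c v • e0 := fun c v => rfl
  have DQ_ins : ∀ c, DQ (ins c) = 0 := fun c => by
    ext v : 1
    rw [DQ_apply, ins_apply, map_smul, De0, smul_zero]; rfl
  have Φ_ins : ∀ c, Φ (ins c) = Finsupp.linearCombination A f c := by
    intro c
    have : Φ.comp ins = Finsupp.linearCombination A f := by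
      refine Finsupp.lhom_ext fun v a => ?_
      simp only [LinearMap.comp_apply, ins, Finsupp.mapRange.linearMap_apply,
        Finsupp.mapRange_single, Φ_single, LinearMap.toSpanSingleton_apply, map_smul, φ0,
        Finsupp.linearCombination_single]
    exact congr($this c)
  have hbdQ : ∀ q : V →₀ P, (∀ v, ∃ p, D p = q v) → ∃ q', DQ q' = q := by
    intro q hq
    classical
    choose p hp using hq
    refine ⟨∑ v ∈ q.support, Finsupp.single v (p v), ?_⟩
    rw [map_sum]
    conv_rhs => rw [← Finsupp.sum_single q, Finsupp.sum]
    refine Finset.sum_congr rfl fun v _ => ?_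
    rw [DQ_single, hp]
  let E : (X × (V →₀ P)) →ₗ[A] (X × (V →₀ P)) :=
    (dX.coprod Φ).prod (-(DQ.comp (LinearMap.snd A X (V →₀ P))))
  have E_apply : ∀ x q, E (x, q) = (dX x + Φ q, - DQ q) := fun x q => by simp [E]
  have DQDQ : ∀ q, DQ (DQ q) = 0 := fun q => by
    ext v : 1
    rw [DQ_apply, DQ_apply, DD]; rfl
  have hE : Function.Exact E E := by
    rintro ⟨x, q⟩
    constructor
    · intro h
      rw [E_apply, Prod.mk_eq_zero, neg_eq_zero] at h
      obtain ⟨h1, h2⟩ := h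
      have h2' : ∀ v, D (q v) = 0 := fun v => congr($h2 v)
      let c : V →₀ A := Finsupp.mapRange.linearMap c0 q
      have hc : ∀ v, c v = c0 (q v) := fun v => rfl
      obtain ⟨q1, hq1⟩ := hbdQ (q - ins c) (by
        intro v
        obtain ⟨p', hp'⟩ := hdec (q v) (h2' v)
        refine ⟨p', ?_⟩
        rw [Finsupp.sub_apply, ins_apply, hc, eq_sub_iff_add_eq, ← hp'])
      have hcm := hind' c ⟨-x - Φ q1, by
        rw [map_sub, ← ΦDQ, hq1, map_sub, ← Φ_ins, map_neg, eq_neg_of_add_eq_zero_left h1]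
        abel⟩
      obtain ⟨q2, hq2⟩ := hbdQ q (by
        intro v
        obtain ⟨p', hp'⟩ := hdec (q v) (h2' v)
        obtain ⟨p, hp⟩ := bd _ (hcm v)
        refine ⟨p' + p, ?_⟩
        rw [map_add, hp, hc, ← hp'])
      obtain ⟨c', y, hy⟩ := hspan' (x + Φ q2) (by rw [map_add, ← ΦDQ, hq2, h1])
      refine ⟨(y, ins c' - q2), ?_⟩
      rw [E_apply, map_sub, map_sub, DQ_ins, Φ_ins, hq2, zero_sub, neg_neg, ← add_sub_assoc, ← hy,
        add_sub_cancel_right]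
    · rintro ⟨⟨y, q'⟩, h⟩
      rw [E_apply] at h
      rw [← h, E_apply, map_add, dXdX, map_neg, map_neg, ΦDQ, DQDQ]
      simp
  let G : (X × (V →₀ P)) →ₗ[A] A :=
    (g.comp (Finsupp.lapply v0)).comp (LinearMap.snd A X (V →₀ P))
  have G_apply : ∀ x q, G (x, q) = g (q v0) := fun x q => rfl
  have hproj : Module.Projective A (V →₀ P) := by
    classical
    exact Module.Projective.of_equiv (finsuppLequivDFinsupp (ι := V) (M := P) A).symm
  obtain ⟨G', hG'⟩ := hTA _ E inferInstance hE G (by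
    refine LinearMap.ext fun ⟨x, q⟩ => ?_
    rw [LinearMap.comp_apply, E_apply, G_apply, Finsupp.neg_apply, DQ_apply, map_neg]
    have : g (D (q v0)) = 0 := congr($hg (q v0))
    rw [this]; simp)
  refine ⟨G'.comp (LinearMap.inl A X (V →₀ P)),
    -(G'.comp ((LinearMap.inr A X (V →₀ P)).comp (Finsupp.lsingle v0))), fun p => ?_⟩
  have h2 := congr($hG' (0, Finsupp.single v0 p))
  rw [LinearMap.comp_apply, E_apply, G_apply, Φ_single, DQ_single, Finsupp.single_eq_same,
    map_zero, zero_add] at h2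
  rw [← h2, LinearMap.neg_apply, LinearMap.comp_apply, LinearMap.comp_apply, LinearMap.comp_apply,
    ← map_neg, ← map_add]
  simp

/-- dual -/
def gorX {S : Type} (A : Type u) [CommRing A] (deg : S → ℕ) : Submodule A ((S →₀ A) →ₗ[A] A) where
  carrier := {x | ∃ N, ∀ s, N ≤ deg s → x (Finsupp.single s 1) = 0}
  zero_mem' := ⟨0, fun _ _ => rfl⟩
  add_mem' := by
    rintro x y ⟨N, hN⟩ ⟨M, hM⟩
    refine ⟨N + M, fun s hs => ?_⟩
    rw [LinearMap.add_apply, hN s (by omega), hM s (by omega), add_zero]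
  smul_mem' := by
    rintro a x ⟨N, hN⟩
    refine ⟨N, fun s hs => ?_⟩
    rw [LinearMap.smul_apply, hN s hs, smul_zero]

namespace GorRes
variable {A : Type u} [CommRing A] {m : Ideal A} {S : Type} {deg : S → ℕ} {s0 : S}
    {D : (S →₀ A) →ₗ[A] (S →₀ A)}

variable (hR : GorRes A m S deg s0 D)
include hR

lemma X_proj : Module.Projective A (gorX A deg) := by
  have hfin : ∀ x : gorX A deg, (Function.support fun s => x.1 (Finsupp.single s 1)).Finite := by
    rintro ⟨x, N, hN⟩
    refine Set.Finite.subset (Set.Finite.biUnion (Set.finite_lt_nat N) (fun j _ => hR.fin j)) ?_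
    intro s hs
    simp only [Set.mem_iUnion, Set.mem_ofPred_eq, exists_prop]
    refine ⟨deg s, ?_, rfl⟩
    by_contra hlt
    exact hs (hN s (by omega))
  let Ψ : gorX A deg →ₗ[A] (S →₀ A) :=
    { toFun := fun x => Finsupp.ofSupportFinite _ (hfin x)
      map_add' := fun x y => by ext s; rfl
      map_smul' := fun a x => by ext s; rfl }
  refine Module.Projective.of_equiv (LinearEquiv.ofBijective Ψ ⟨?_, ?_⟩).symm
  · intro x y hxy
    ext s : 3
    exact congr($hxy s)
  · intro c
    refine ⟨⟨Finsupp.linearCombination A c, ?_⟩, ?_⟩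
    · refine ⟨(c.support.sup deg) + 1, fun s hs => ?_⟩
      rw [Finsupp.linearCombination_single, one_smul]
      by_contra hne
      have := Finset.le_sup (f := deg) (Finsupp.mem_support_iff.2 hne)
      omega
    · ext s
      change Finsupp.linearCombination A c (Finsupp.single s 1) = c s
      rw [Finsupp.linearCombination_single, one_smul]

lemma cycle_decomp (p : S →₀ A) (hp : D p = 0) : ∃ p', p = D p' + Finsupp.single s0 (p s0) := by
  classical
  obtain ⟨N, hN⟩ : ∃ N, p ∈ Finsupp.supported A A {s | deg s < N} :=
    ⟨p.support.sup deg + 1, fun s hs => Nat.lt_succ_of_le (Finset.le_sup (f := deg) hs)⟩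
  have hle : ∀ N p, p ∈ Finsupp.supported A A {s | deg s < N + 1} →
      D p ∈ Finsupp.supported A A {s | deg s < N} := fun N p hp =>
    gor_mem_supp D _ _ (fun s hs => Finsupp.supported_mono
      (fun t ht => by simp at hs ht ⊢; omega) (hR.hD s)) p hp
  induction N generalizing p with
  | zero =>
    have : p = 0 := by
      rw [← Finsupp.support_eq_empty, Finset.eq_empty_iff_forall_notMem]
      intro s hs
      exact absurd (hN hs) (by simp)
    subst this
    exact ⟨0, by simp⟩
  | succ N ih =>
    rcases N with _ | N
    · have h0 : p ∈ gorP A deg 0 := Finsupp.supported_mono (fun t ht => by simp at ht ⊢; omega) hN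
      exact ⟨0, by rw [map_zero, zero_add]; exact hR.mem_zero h0⟩
    · set p1 := p.filter (fun s => deg s = N + 1) with hp1
      set p2 := p.filter (fun s => ¬ deg s = N + 1) with hp2
      have hp12 : p1 + p2 = p := Finsupp.filter_add_filter_not p _
      have h1 : p1 ∈ gorP A deg (N + 1) := fun s hs => by
        rw [Finset.mem_coe, Finsupp.support_filter, Finset.mem_filter] at hs
        exact hs.2
      have h2 : p2 ∈ Finsupp.supported A A {s | deg s < N + 1} := fun s hs => by
        rw [Finset.mem_coe, Finsupp.support_filter, Finset.mem_filter] at hs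
        have := hN hs.1
        simp at this ⊢
        omega
      have hD1 := hR.D_mem h1
      have hD2 := hle _ _ h2
      have hsum : D p1 + D p2 = 0 := by rw [← map_add, hp12, hp]
      have hz : D p1 = 0 := by
        ext s
        by_cases hs : deg s = N
        · have := (Finsupp.mem_supported' _ _).1 hD2 s (by simp [hs])
          have h3 := congr($hsum s)
          simpa [this] using h3
        · exact (Finsupp.mem_supported' _ _).1 hD1 s hs
      have hz2 : D p2 = 0 := by rwa [hz, zero_add] at hsum
      obtain ⟨q1, -, hq1⟩ := hR.cyc N p1 h1 hz
      obtain ⟨q2, hq2⟩ := ih p2 hz2 h2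
      refine ⟨q1 + q2, ?_⟩
      have h0 : p1 s0 = 0 := (Finsupp.mem_supported' _ _).1 h1 s0 (by
        rw [Set.mem_ofPred_eq, (hR.deg0 s0).2 rfl]; omega)
      have h4 : p s0 = p2 s0 := by rw [← hp12, Finsupp.add_apply, h0, zero_add]
      rw [map_add, hq1, h4, add_assoc, ← hq2, hp12]

theorem main [hm : m.IsMaximal]
    (hTA : ∀ (F : Type u) [AddCommGroup F] [Module A F] (E : F →ₗ[A] F),
      Module.Projective A F → Function.Exact E E → ∀ G : F →ₗ[A] A, G.comp E = 0 →
        ∃ G' : F →ₗ[A] A, G'.comp E = G) :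
    ∃ N, ∀ l, N ≤ l → ∀ g : (S →₀ A) →ₗ[A] A, g.comp D = 0 →
      (∀ s, deg s ≠ l → g (Finsupp.single s 1) = 0) →
      ∃ h : (S →₀ A) →ₗ[A] A, ∀ s, deg s = l →
        g (Finsupp.single s 1) = h (D (Finsupp.single s 1)) := by
  obtain ⟨L, L0, Ldeg, LD⟩ := hR.exists_L
  have hXD : ∀ x ∈ gorX A deg, (x.comp ((gorEps A deg).comp D)) ∈ gorX A deg := by
    rintro x ⟨N, hN⟩
    refine ⟨N + 1, fun s hs => ?_⟩
    obtain ⟨j, hj⟩ : ∃ j, deg s = j + 1 := ⟨deg s - 1, by omega⟩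
    have h1 := hR.hDs s j hj
    rw [LinearMap.comp_apply, LinearMap.comp_apply, eps_of_mem h1, map_smul]
    rw [gor_ext_supp x 0 _ (fun t ht => hN t (by simp at ht; omega)) _ h1]
    simp
  let dX : gorX A deg →ₗ[A] gorX A deg :=
    (LinearMap.lcomp A A ((gorEps A deg).comp D)).restrict hXD
  have dX_apply : ∀ x p, (dX x).1 p = x.1 (gorEps A deg (D p)) := fun x p => rfl
  have dXdX : ∀ x, dX (dX x) = 0 := fun x => by
    ext s : 3
    simp only [LinearMap.comp_apply, Finsupp.lsingle_apply]
    rw [dX_apply, dX_apply, hR.eps_D, eps_eps, hR.DD, neg_zero, map_zero]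
    rfl
  -- φ
  have hφ : ∀ (x : gorX A deg) p, x.1.comp (L p) ∈ gorX A deg := by
    rintro ⟨x, N, hN⟩ p
    refine ⟨N, fun s hs => ?_⟩
    have : (x.comp ((LinearMap.applyₗ (Finsupp.single s 1)).comp L)) = 0 := by
      ext t
      exact gor_ext_supp x 0 _ (fun t' ht => hN t' (by simp at ht; omega)) _ (Ldeg t s)
    exact congr($this p)
  let φ : gorX A deg → (S →₀ A) →ₗ[A] gorX A deg := fun x =>
    { toFun := fun p => ⟨x.1.comp (L p), hφ x p⟩
      map_add' := fun p q => by ext s : 3; simp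
      map_smul' := fun a p => by ext s : 3; simp }
  have φ_apply : ∀ x p q, (φ x p).1 q = x.1 (L p q) := fun x p q => rfl
  have φ0 : ∀ x, φ x (Finsupp.single s0 1) = x := fun x => by
    ext s : 3
    simp only [LinearMap.comp_apply, Finsupp.lsingle_apply]
    rw [φ_apply, L0]; rfl
  have φD : ∀ x : gorX A deg, x.1.comp D = 0 → ∀ p, φ x (D p) = dX (φ x p) := by
    intro x hx p
    have hx' : ∀ y, x.1 (D y) = 0 := fun y => congr($hx y)
    apply Subtype.ext
    refine LinearMap.ext fun q => ?_
    rw [φ_apply, dX_apply, φ_apply]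
    have h1 := LD p (gorEps A deg q)
    rw [eps_eps] at h1
    rw [← h1, map_sub, hx', hR.eps_D, map_neg, map_neg, zero_sub]
  have cocyc1 : ∀ x : gorX A deg, x.1.comp D = 0 → dX x = 0 := fun x hx => by
    rw [← φ0 x, ← φD x hx, hR.hD0, map_zero]
  have hXe : ∀ x ∈ gorX A deg, (x.comp (gorEps A deg)) ∈ gorX A deg := by
    rintro x ⟨N, hN⟩
    refine ⟨N, fun s hs => ?_⟩
    rw [LinearMap.comp_apply, eps_of_mem (single_mem s 1), map_smul, hN s hs, smul_zero]
  have cocyc2 : ∀ x : gorX A deg, dX x = 0 → x.1.comp D = 0 := fun x hx => by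
    have h1 := cocyc1 ⟨x.1.comp (gorEps A deg), hXe _ x.2⟩ (congrArg Subtype.val hx)
    refine LinearMap.ext fun p => ?_
    have h2 := congrArg (fun y => y.1 p) h1
    simp only [dX_apply, LinearMap.comp_apply, eps_eps] at h2
    exact h2
  -- homology
  have hkill : ∀ a ∈ m, ∀ z, dX z = 0 → ∃ y, dX y = a • z := by
    intro a ha z hz
    obtain ⟨p, -, hp⟩ := hR.bd a ha
    refine ⟨φ z p, ?_⟩
    rw [← φD z (cocyc2 _ hz), hp, ← mul_one a, ← smul_eq_mul, ← Finsupp.smul_single, map_smul, φ0,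
      smul_eq_mul, mul_one]
  obtain ⟨V, f, hfZ, hspan', hind'⟩ := gor_homology_basis (X := gorX A deg) m dX hkill
  have hproj := hR.X_proj
  by_cases hV : Nonempty V
  · obtain ⟨v0⟩ := hV
    obtain ⟨N, hN⟩ := (f v0).2
    refine ⟨N, fun l hl g hg hgl => ?_⟩
    obtain ⟨G1, G2, hG⟩ := gor_cone (X := gorX A deg) (P := S →₀ A) m hTA dX D (Finsupp.single s0 1)
      (Finsupp.lapply s0) f (fun v => φ (f v)) dXdX hR.DD hR.hD0 (fun v => φ0 _)
      (fun v p => φD _ (cocyc2 _ (hfZ v)) p)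
      (fun p hp => by
        obtain ⟨p', h⟩ := hR.cycle_decomp p hp
        refine ⟨p', h.trans ?_⟩
        rw [Finsupp.smul_single, smul_eq_mul, mul_one]; rfl)
      (fun a ha => by
        obtain ⟨p, -, hp⟩ := hR.bd a ha
        refine ⟨p, hp.trans ?_⟩
        rw [Finsupp.smul_single, smul_eq_mul, mul_one])
      hspan' hind' v0 g hg
    refine ⟨G2, fun s hs => ?_⟩
    have h1 : φ (f v0) (Finsupp.single s 1) = 0 := by
      ext t : 3
      simp only [LinearMap.comp_apply, Finsupp.lsingle_apply]
      rw [φ_apply]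
      exact gor_ext_supp (f v0).1 0 _ (fun t' ht => hN t' (by simp at ht; omega)) _ (Ldeg s t)
    rw [hG, h1, map_zero, zero_add]
  · refine ⟨0, fun l hl g hg hgl => ?_⟩
    have hgX : g ∈ gorX A deg := ⟨l + 1, fun s hs => hgl s (by omega)⟩
    obtain ⟨c, y, hy⟩ := hspan' ⟨g, hgX⟩ (cocyc1 _ hg)
    have hc : c = 0 := by
      ext v
      exact absurd ⟨v⟩ hV
    rw [hc, map_zero, add_zero] at hy
    refine ⟨y.1.comp (gorEps A deg), fun s hs => ?_⟩
    exact congrArg (fun z => z.1 (Finsupp.single s 1)) hy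

end GorRes

lemma gor_resolution (A : Type u) [CommRing A] [IsNoetherianRing A] (m : Ideal A) :
    ∃ (n : ℕ → ℕ) (i0 : Fin (n 0))
      (del : ∀ j, (Fin (n (j + 1)) →₀ A) →ₗ[A] (Fin (n j) →₀ A)),
      (∀ i, i = i0) ∧ (∀ p, p ∈ LinearMap.range (del 0) ↔ p i0 ∈ m) ∧
      ∀ j, Function.Exact (del (j + 1)) (del j) := by
  have step : ∀ st : (Σ n : ℕ, Submodule A (Fin n →₀ A)),
      ∃ (n' : ℕ) (del : (Fin n' →₀ A) →ₗ[A] (Fin st.1 →₀ A)), LinearMap.range del = st.2 := by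
    rintro ⟨n, K⟩
    have hK : K.FG := IsNoetherian.noetherian K
    obtain ⟨k, s, hs⟩ := Submodule.fg_iff_exists_fin_generating_family.1 hK
    refine ⟨k, Finsupp.linearCombination A s, ?_⟩
    rw [Finsupp.range_linearCombination, hs]
  choose n' del hdel using step
  let K0 : Submodule A (Fin 1 →₀ A) := Submodule.comap (Finsupp.lapply 0) m
  let st : ℕ → (Σ n : ℕ, Submodule A (Fin n →₀ A)) := fun j =>
    Nat.rec ⟨1, K0⟩ (fun _ s => ⟨n' s, LinearMap.ker (del s)⟩) j
  refine ⟨fun j => (st j).1, (0 : Fin 1), fun j => del (st j), fun i => Subsingleton.elim (α := Fin 1) _ _,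
    fun p => ?_, fun j => ?_⟩
  · rw [hdel]; rfl
  · rw [LinearMap.exact_iff]
    exact (hdel (st (j + 1))).symm

section
variable {A : Type u} [CommRing A] {n : ℕ → ℕ}

/-- inclusion of an index -/
abbrev gorMk (n : ℕ → ℕ) (j : ℕ) : Fin (n j) → (Σ j, Fin (n j)) := fun i => ⟨j, i⟩

lemma gorMk_inj (j : ℕ) : Function.Injective (gorMk n j) := fun i i' h => by
  simpa using h

/-- embedding -/
noncomputable def gorEmb (A : Type u) [CommRing A] (n : ℕ → ℕ) (j : ℕ) :
    (Fin (n j) →₀ A) →ₗ[A] ((Σ j, Fin (n j)) →₀ A) :=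
  Finsupp.lmapDomain A A (gorMk n j)

lemma gorEmb_single (j : ℕ) (i : Fin (n j)) (a : A) :
    gorEmb A n j (Finsupp.single i a) = Finsupp.single ⟨j, i⟩ a := by
  simp [gorEmb]

lemma gorEmb_apply (j : ℕ) (q : Fin (n j) →₀ A) (i : Fin (n j)) : gorEmb A n j q ⟨j, i⟩ = q i :=
  Finsupp.mapDomain_apply (gorMk_inj j) _ _

lemma gorEmb_apply_ne (j : ℕ) (q : Fin (n j) →₀ A) (s : Σ j, Fin (n j)) (h : s.1 ≠ j) :
    gorEmb A n j q s = 0 := by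
  refine Finsupp.mapDomain_of_notMem_range (f := gorMk n j) q s ?_
  rintro ⟨i, rfl⟩
  exact h rfl

lemma gorEmb_mem (j : ℕ) (q : Fin (n j) →₀ A) :
    gorEmb A n j q ∈ gorP A (Sigma.fst : (Σ j, Fin (n j)) → ℕ) j := by
  refine (Finsupp.mem_supported' _ _).2 fun s hs => gorEmb_apply_ne j q s hs

lemma gorEmb_surj (j : ℕ) (p) (hp : p ∈ gorP A (Sigma.fst : (Σ j, Fin (n j)) → ℕ) j) :
    ∃ q, gorEmb A n j q = p := by
  refine gor_mem_supp LinearMap.id _ (LinearMap.range (gorEmb A n j)) ?_ p hp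
  rintro ⟨j', i⟩ rfl
  exact ⟨_, gorEmb_single _ i 1⟩

lemma gorEmb_inj (j : ℕ) : Function.Injective (gorEmb A n j) :=
  Finsupp.mapDomain_injective (gorMk_inj j)

/-- total differential -/
noncomputable def gorD (del : ∀ j, (Fin (n (j + 1)) →₀ A) →ₗ[A] (Fin (n j) →₀ A)) :
    ((Σ j, Fin (n j)) →₀ A) →ₗ[A] ((Σ j, Fin (n j)) →₀ A) :=
  Finsupp.linearCombination A (fun s => match s with
    | ⟨0, _⟩ => 0
    | ⟨j + 1, i⟩ => gorEmb A n j (del j (Finsupp.single i 1)))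

variable (del : ∀ j, (Fin (n (j + 1)) →₀ A) →ₗ[A] (Fin (n j) →₀ A))

lemma gorD_zero (q) : gorD del (gorEmb A n 0 q) = 0 := by
  have : (gorD del).comp (gorEmb A n 0) = 0 := by
    ext i : 2
    simp [gorEmb_single, gorD]
  exact congr($this q)

lemma gorD_succ (j : ℕ) (q) : gorD del (gorEmb A n (j + 1) q) = gorEmb A n j (del j q) := by
  have : (gorD del).comp (gorEmb A n (j + 1)) = (gorEmb A n j).comp (del j) := by
    ext i : 2
    simp [gorEmb_single, gorD]
  exact congr($this q)

lemma gor_isRes (m : Ideal A) (i0 : Fin (n 0)) (h0 : ∀ i, i = i0)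
    (hr : ∀ p, p ∈ LinearMap.range (del 0) ↔ p i0 ∈ m)
    (hex : ∀ j, Function.Exact (del (j + 1)) (del j)) :
    GorRes A m (Σ j, Fin (n j)) Sigma.fst ⟨0, i0⟩ (gorD del) where
  fin j := by
    refine (Set.finite_range (gorMk n j)).subset ?_
    rintro ⟨j', i⟩ rfl
    exact ⟨i, rfl⟩
  deg0 := by
    rintro ⟨j, i⟩
    constructor
    · rintro rfl
      rw [h0 i]
    · intro h
      exact congrArg Sigma.fst h
  hD0 := by rw [← gorEmb_single, gorD_zero]
  hDs := by
    rintro ⟨j', i⟩ j rfl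
    rw [← gorEmb_single, gorD_succ]
    exact gorEmb_mem _ _
  DD := by
    intro p
    have : (gorD del).comp (gorD del) = 0 := by
      ext s : 2
      obtain ⟨j, i⟩ := s
      simp only [LinearMap.comp_apply, Finsupp.lsingle_apply]
      rw [← gorEmb_single]
      rcases j with _ | _ | j
      · rw [gorD_zero, map_zero]; rfl
      · rw [gorD_succ, gorD_zero]; rfl
      · rw [gorD_succ, gorD_succ, (hex j).apply_apply_eq_zero, map_zero]; rfl
    exact congr($this p)
  cyc := by
    intro j p hp h
    obtain ⟨q, rfl⟩ := gorEmb_surj _ _ hp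
    rw [gorD_succ] at h
    obtain ⟨q', rfl⟩ := (hex j q).1 (gorEmb_inj j (h.trans (map_zero _).symm))
    exact ⟨gorEmb A n (j + 2) q', gorEmb_mem _ _, gorD_succ _ _ _⟩
  bd := by
    intro a ha
    obtain ⟨q, hq⟩ := (hr (Finsupp.single i0 a)).2 (by simpa using ha)
    refine ⟨gorEmb A n 1 q, gorEmb_mem _ _, ?_⟩
    rw [gorD_succ, hq, gorEmb_single]
  bd' := by
    intro p
    induction p using Finsupp.induction_linear with
    | zero => simp
    | add f g hf hg => rw [map_add]; exact m.add_mem hf hg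
    | single s a =>
      obtain ⟨j, i⟩ := s
      rw [← gorEmb_single]
      rcases j with _ | _ | j
      · rw [gorD_zero]; exact m.zero_mem
      · rw [gorD_succ, gorEmb_apply]
        exact (hr _).1 ⟨_, rfl⟩
      · rw [gorD_succ, gorEmb_apply_ne _ _ _ (by simp)]; exact m.zero_mem

lemma gor_dual_exact (m : Ideal A) [m.IsMaximal] (i0 : Fin (n 0)) (h0 : ∀ i, i = i0)
    (hr : ∀ p, p ∈ LinearMap.range (del 0) ↔ p i0 ∈ m)
    (hex : ∀ j, Function.Exact (del (j + 1)) (del j))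
    (hTA : ∀ (F : Type u) [AddCommGroup F] [Module A F] (E : F →ₗ[A] F),
      Module.Projective A F → Function.Exact E E → ∀ G : F →ₗ[A] A, G.comp E = 0 →
        ∃ G' : F →ₗ[A] A, G'.comp E = G) :
    ∃ N, ∀ l, N ≤ l → ∀ g : (Fin (n (l + 1)) →₀ A) →ₗ[A] A, g.comp (del (l + 1)) = 0 →
      ∃ h : (Fin (n l) →₀ A) →ₗ[A] A, h.comp (del l) = g := by
  obtain ⟨N, hN⟩ := (gor_isRes del m i0 h0 hr hex).main hTA
  refine ⟨N, fun l hl g hg => ?_⟩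
  let pr : ((Σ j, Fin (n j)) →₀ A) →ₗ[A] (Fin (n (l + 1)) →₀ A) :=
    Finsupp.lcomapDomain (gorMk n (l + 1)) (gorMk_inj _)
  have pr1 : ∀ q, pr (gorEmb A n (l + 1) q) = q := fun q =>
    Finsupp.comapDomain_mapDomain _ (gorMk_inj _) _
  have pr2 : ∀ j q, j ≠ l + 1 → pr (gorEmb A n j q) = 0 := fun j q hj => by
    ext i
    exact gorEmb_apply_ne j q _ (Ne.symm hj)
  obtain ⟨h, hh⟩ := hN (l + 1) (by omega) (g.comp pr) (by
    ext s : 2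
    obtain ⟨j, i⟩ := s
    simp only [LinearMap.comp_apply, Finsupp.lsingle_apply]
    rw [← gorEmb_single]
    rcases j with _ | j
    · rw [gorD_zero, map_zero, map_zero]; rfl
    · rw [gorD_succ]
      by_cases hj : j = l + 1
      · subst hj
        rw [pr1]
        exact congr($hg (Finsupp.single i 1))
      · rw [pr2 _ _ hj, map_zero]; rfl) (by
    rintro ⟨j, i⟩ hj
    rw [← gorEmb_single, LinearMap.comp_apply, pr2 _ _ hj, map_zero])
  refine ⟨h.comp (gorEmb A n l), ?_⟩
  ext i : 2
  have := hh ⟨l + 1, i⟩ rfl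
  rw [← gorEmb_single, gorD_succ, LinearMap.comp_apply, pr1] at this
  exact this.symm
end

lemma gor_shift {R : Type u} [CommRing R] (M : ModuleCat.{u} R) (l : ℕ) :
    ∀ (P : ℕ → Type u) [∀ j, AddCommGroup (P j)] [∀ j, Module R (P j)]
    [∀ j, Module.Projective R (P j)] (del : ∀ j, P (j + 1) →ₗ[R] P j)
    (_ : ∀ j, Function.Exact (del (j + 1)) (del j))
    (N : Type u) [AddCommGroup N] [Module R N] (π : P 0 →ₗ[R] N) (_ : Function.Surjective π)
    (_ : Function.Exact (del 0) π)
    (_ : ∀ g : P (l + 1) →ₗ[R] M, g.comp (del (l + 1)) = 0 → ∃ h : P l →ₗ[R] M, h.comp (del l) = g),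
    Subsingleton (Ext.{u} (ModuleCat.of R N) M (l + 1)) := by
  induction l with
  | zero =>
    intro P _ _ _ del hex N _ _ π hπ hex0 hl
    have hex1 : Function.Exact (LinearMap.ker π).subtype π := LinearMap.exact_subtype_ker_map π
    have hS := gor_ses (LinearMap.ker π).subtype π (Submodule.injective_subtype _) hπ hex1
      (gor_ofHom_zero hex1)
    have hproj : Projective (ModuleCat.of R (P 0)) := inferInstance
    have key : ∀ a : Ext.{u} (ModuleCat.of R N) M 1, a = 0 := fun a => by
      obtain ⟨x, hx⟩ := Ext.contravariant_sequence_exact₃ hS M a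
        (Ext.eq_zero_of_projective (P := ModuleCat.of R (P 0)) _) (n₀ := 0) rfl
      obtain ⟨α, rfl⟩ := (Ext.mk₀_bijective _ _).2 x
      let π' : P 1 →ₗ[R] LinearMap.ker π := (del 0).codRestrict _ (fun p => hex0.apply_apply_eq_zero p)
      obtain ⟨h, hh⟩ := hl (α.hom.comp π') (by
        refine LinearMap.ext fun p => ?_
        have : π' (del 1 p) = 0 := Subtype.ext ((hex 0).apply_apply_eq_zero p)
        rw [LinearMap.comp_apply, LinearMap.comp_apply, this, map_zero]; rfl)
      have hα : α = ModuleCat.ofHom (LinearMap.ker π).subtype ≫ ModuleCat.ofHom h := by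
        ext ⟨y, hy⟩
        obtain ⟨p, rfl⟩ := (hex0 y).1 hy
        exact congr($hh p).symm
      rw [← hx, hα, ← Ext.mk₀_comp_mk₀]
      exact hS.extClass_comp_assoc _
    exact ⟨fun a b => by rw [key a, key b]⟩
  | succ l ih =>
    intro P _ _ _ del hex N _ _ π hπ hex0 hl
    have hex1 : Function.Exact (LinearMap.ker π).subtype π := LinearMap.exact_subtype_ker_map π
    have hS := gor_ses (LinearMap.ker π).subtype π (Submodule.injective_subtype _) hπ hex1
      (gor_ofHom_zero hex1)
    have hproj : Projective (ModuleCat.of R (P 0)) := inferInstance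
    let π' : P 1 →ₗ[R] LinearMap.ker π := (del 0).codRestrict _ (fun p => hex0.apply_apply_eq_zero p)
    have hK := ih (fun j => P (j + 1)) (fun j => del (j + 1)) (fun j => hex (j + 1))
      (LinearMap.ker π) π' (by
        rintro ⟨y, hy⟩
        obtain ⟨p, rfl⟩ := (hex0 y).1 hy
        exact ⟨p, rfl⟩) (by
        intro p
        rw [← hex 0 p]
        exact Subtype.ext_iff) hl
    have key : ∀ a : Ext.{u} (ModuleCat.of R N) M (l + 1 + 1), a = 0 := fun a => by
      obtain ⟨x, hx⟩ := Ext.contravariant_sequence_exact₃ hS M a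
        (Ext.eq_zero_of_projective (P := ModuleCat.of R (P 0)) _) (n₀ := l + 1) (by omega)
      rw [← hx, @Subsingleton.elim _ hK x 0, Ext.comp_zero]
    exact ⟨fun a b => by rw [key a, key b]⟩

lemma gor_local_dual {A : Type u} [CommRing A] (S : Submonoid A) {P0 P1 P2 : Type u}
    [AddCommGroup P0] [Module A P0] [AddCommGroup P1] [Module A P1] [AddCommGroup P2] [Module A P2]
    [Module.FinitePresentation A P0] [Module.FinitePresentation A P1]
    [Module.FinitePresentation A P2]
    (d1 : P2 →ₗ[A] P1) (d0 : P1 →ₗ[A] P0)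
    (hd : ∀ g : P1 →ₗ[A] A, g.comp d1 = 0 → ∃ h : P0 →ₗ[A] A, h.comp d0 = g)
    (g' : LocalizedModule S P1 →ₗ[Localization S] Localization S)
    (hg' : g'.comp (LocalizedModule.map S d1) = 0) :
    ∃ h' : LocalizedModule S P0 →ₗ[Localization S] Localization S,
      h'.comp (LocalizedModule.map S d0) = g' := by
  let F : ∀ (P : Type u) [AddCommGroup P] [Module A P], (P →ₗ[A] A) →ₗ[A] _ := fun P _ _ =>
    IsLocalizedModule.mapExtendScalars S (LocalizedModule.mkLinearMap S P)
      (Algebra.linearMap A (Localization S)) (Localization S)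
  have hF : ∀ (P Q : Type u) [AddCommGroup P] [Module A P] [AddCommGroup Q] [Module A Q]
      (g : P →ₗ[A] A) (d : Q →ₗ[A] P), F Q (g.comp d) = (F P g).comp (LocalizedModule.map S d) := by
    intro P Q _ _ _ _ g d
    refine LinearMap.ext fun x => ?_
    induction x using LocalizedModule.induction_on with
    | h x s =>
      rw [LinearMap.comp_apply, LocalizedModule.map_mk, IsLocalizedModule.mk_eq_mk',
        IsLocalizedModule.mk_eq_mk']
      simp only [F, IsLocalizedModule.mapExtendScalars_apply_apply, IsLocalizedModule.map_mk']
      rfl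
  obtain ⟨⟨g, s⟩, hgs⟩ := IsLocalizedModule.surj S (F P1) g'
  change s • g' = F P1 g at hgs
  have h0 : F P2 (g.comp d1) = F P2 0 := by
    rw [hF, ← hgs, map_zero, LinearMap.smul_comp, hg', smul_zero]
  obtain ⟨t, ht⟩ := IsLocalizedModule.exists_of_eq (S := S) h0
  obtain ⟨h, hh⟩ := hd (t • g) (by rw [LinearMap.smul_comp, ht, smul_zero])
  obtain ⟨h', hh'⟩ := ((Module.End.isUnit_iff _).1
    (IsLocalizedModule.map_units (S := S) (F P0) (t * s))).2 (F P0 h)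
  refine ⟨h', ?_⟩
  refine ((Module.End.isUnit_iff _).1 (IsLocalizedModule.map_units (S := S) (F P1) (t * s))).1 ?_
  change ((t * s : S) : A) • h' = F P0 h at hh'
  change ((t * s : S) : A) • (h'.comp (LocalizedModule.map S d0)) = ((t * s : S) : A) • g'
  rw [← LinearMap.smul_comp, hh', ← hF, hh, Submonoid.coe_mul, mul_smul]
  change F P1 ((t : A) • g) = _
  rw [map_smul, ← hgs]
  rfl

lemma gor_local_injDim {A : Type u} [CommRing A] [IsNoetherianRing A] (m : Ideal A)
    [hm : m.IsMaximal]
    (hTA : ∀ (F : Type u) [AddCommGroup F] [Module A F] (E : F →ₗ[A] F),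
      Module.Projective A F → Function.Exact E E → ∀ G : F →ₗ[A] A, G.comp E = 0 →
        ∃ G' : F →ₗ[A] A, G'.comp E = G) :
    ∃ N, HasInjectiveDimensionLE
      (ModuleCat.of (Localization.AtPrime m) (Localization.AtPrime m)) N := by
  obtain ⟨n, i0, del, h0, hr, hex⟩ := gor_resolution A m
  obtain ⟨N, hN⟩ := gor_dual_exact del m i0 h0 hr hex hTA
  let S := m.primeCompl
  refine ⟨N, gor_injDim_of_residue _ N fun l hl => ?_⟩
  obtain ⟨l, rfl⟩ : ∃ k, l = k + 1 := ⟨l - 1, by omega⟩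
  let π : (Fin (n 0) →₀ A) →ₗ[A] (A ⧸ m) := (Submodule.mkQ m).comp (Finsupp.lapply i0)
  have hπ : Function.Surjective π := by
    refine (Submodule.mkQ_surjective m).comp fun a => ⟨Finsupp.single i0 a, by simp⟩
  have hπex : Function.Exact (del 0) π := by
    intro p
    exact (Submodule.Quotient.mk_eq_zero m).trans (hr p).symm
  let qf := Submodule.toLocalizedQuotient' (Localization S) S
    (Algebra.linearMap A (Localization S)) m
  let π' := IsLocalizedModule.mapExtendScalars S (LocalizedModule.mkLinearMap S _) qf
    (Localization S) π
  have hQ := gor_shift (ModuleCat.of (Localization S) (Localization S)) l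
    (fun j => LocalizedModule S (Fin (n j) →₀ A)) (fun j => LocalizedModule.map S (del j))
    (fun j => LocalizedModule.map_exact S _ _ (hex j)) _ π'
    (IsLocalizedModule.map_surjective S (LocalizedModule.mkLinearMap S _) qf π hπ)
    (IsLocalizedModule.map_exact S (LocalizedModule.mkLinearMap S _) (LocalizedModule.mkLinearMap S _) qf _ _ hπex)
    (fun g hg => gor_local_dual S (del (l + 1)) (del l) (hN l (by omega)) g hg)
  refine gor_ext_equiv (Submodule.quotEquivOfEq _ _ ?_) _ _ hQ
  rw [Ideal.localized'_eq_map]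
  exact Localization.AtPrime.map_eq_maximalIdeal

section
attribute [local instance] RingHomInvPair.of_ringEquiv

lemma gor_ringEquiv {R R' : Type u} [CommRing R] [CommRing R'] (e : R ≃+* R') (n : ℕ)
    (h : HasInjectiveDimensionLE (ModuleCat.of R R) n) :
    HasInjectiveDimensionLE (ModuleCat.of R' R') n := by
  let eM : ModuleCat.of R R ≃ₛₗ[RingHomClass.toRingHom e] ModuleCat.of R' R' :=
    { e.toAddEquiv with
      map_smul' := fun r x => map_mul e r x }
  exact (ModuleCat.hasInjectiveDimensionLE_iff_of_semiLinearEquiv e eM n).1 h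

end

lemma gor_localize {R : Type u} [CommRing R] [IsNoetherianRing R] (S : Submonoid R) (n : ℕ)
    (h : HasInjectiveDimensionLE (ModuleCat.of R R) n) :
    HasInjectiveDimensionLE (ModuleCat.of (Localization S) (Localization S)) n := by
  have h3 := ModuleCat.localizedModule_hasInjectiveDimensionLE n S (ModuleCat.of R R)
  let f : ModuleCat.of R R →ₗ[R] Localization S := Algebra.linearMap R (Localization S)
  have i1 : IsLocalizedModule S f :=
    inferInstanceAs (IsLocalizedModule S (Algebra.linearMap R (Localization S)))
  have i2 := ModuleCat.localizedModule_isLocalizedModule (ModuleCat.of R R) S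
  let e := IsLocalizedModule.linearEquiv S f ((ModuleCat.of R R).localizedModuleMkLinearMap S)
  exact (ModuleCat.hasInjectiveDimensionLE_iff_of_linearEquiv
    (e.extendScalarsOfIsLocalization S (Localization S)) n).2 h3

lemma gor_prime {A : Type u} [CommRing A] [IsNoetherianRing A] (m p : Ideal A) [hm : m.IsMaximal]
    [hp : p.IsPrime] (hpm : p ≤ m) (n : ℕ)
    (h : HasInjectiveDimensionLE
      (ModuleCat.of (Localization.AtPrime m) (Localization.AtPrime m)) n) :
    HasInjectiveDimensionLE (ModuleCat.of (Localization.AtPrime p) (Localization.AtPrime p)) n := by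
  have hdisj : Disjoint (m.primeCompl : Set A) (p : Set A) := by
    rw [Set.disjoint_left]
    exact fun x hx hxp => hx (hpm hxp)
  let q : Ideal (Localization.AtPrime m) := p.map (algebraMap A _)
  have hq : q.IsPrime := IsLocalization.isPrime_of_isPrime_disjoint m.primeCompl _ p hp hdisj
  have hqc : q.comap (algebraMap A _) = p :=
    IsLocalization.under_map_of_isPrime_disjoint m.primeCompl (Localization.AtPrime m) hp hdisj
  have h1 := gor_localize q.primeCompl n h
  have h2 := gor_ringEquiv
    (IsLocalization.localizationLocalizationAtPrimeIsoLocalization m.primeCompl q).symm.toRingEquiv n h1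
  clear_value q
  subst hqc
  exact h2

theorem gor_backward (A : Type u) [CommRing A] [IsNoetherianRing A]
    (h : ∀ (X : ℤ → Type u) (_ : ∀ n, AddCommGroup (X n)) (_ : ∀ n, Module A (X n))
        (d : ∀ n, X n →ₗ[A] X (n + 1)),
        (∀ n, Module.Projective A (X n)) →
        (∀ n, Function.Exact (d n) (d (n + 1))) →
        IsTotallyAcyclic A X d) : IsGorensteinRing A := by
  intro p hp
  obtain ⟨m, hm, hpm⟩ := Ideal.exists_le_maximal p hp.ne_top
  obtain ⟨N, hN⟩ := gor_local_injDim m (by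
    intro F _ _ E hF hE G hG
    obtain ⟨-, h2⟩ := h (fun _ => F) (fun _ => inferInstance) (fun _ => inferInstance) (fun _ => E)
      (fun _ => hF) (fun _ => hE)
    exact (h2 A inferInstance 0 G).1 hG)
  exact gor_to_finite _ N (gor_prime m p hpm N hN)

/-- A commutative noetherian ring of finite Krull dimension is Gorenstein iff every acyclic
complex of projective modules is totally acyclic. -/
theorem gorenstein_iff_acyclic_projective_totallyAcyclic
    (A : Type u) [CommRing A] [IsNoetherianRing A] (hdim : ringKrullDim A < ⊤) :
    IsGorensteinRing A ↔
      ∀ (X : ℤ → Type u) (_ : ∀ n, AddCommGroup (X n)) (_ : ∀ n, Module A (X n))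
        (d : ∀ n, X n →ₗ[A] X (n + 1)),
        (∀ n, Module.Projective A (X n)) →
        (∀ n, Function.Exact (d n) (d (n + 1))) →
        IsTotallyAcyclic A X d := by
  constructor
  · intro hG X _ _ d hP hex
    exact gor_forward A hdim hG X d hP hex
  · exact gor_backward A
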